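/- arXiv:2303.13086 — 10 statements merged into one kernel-verified Lean document; each statement's English description precedes it below -/
import Mathlib

section
/- Along every solution t ↦ ζ(t) = (v₁(t), v₂(t), v₃(t), Γ₂(t), Γ₃(t)) of the reduced pendulum-skate dynamics ζ' = f(ζ), the quantity C₁(t) := (I₂·Γ₂(t)² + I₃·Γ₃(t)²)·v₂(t) is constant in t. -/
/-- The reduced pendulum-skate vector field on `ℝ⁵`, with coordinates
`ζ = (v₁, v₂, v₃, Γ₂, Γ₃)` indexed by `0, 1, 2, 3, 4`. -/
noncomputable def skateF (m g l I₁ I₂ I₃ : ℝ) (ζ : Fin 5 → ℝ) : Fin 5 → ℝ :=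
  ![(((I₂ + m * l ^ 2 - I₃) * ζ 4 * ζ 1 ^ 2 + m * g * l) * ζ 3 + m * l * ζ 4 * ζ 1 * ζ 2) /
      (I₁ + m * l ^ 2),
    2 * (I₃ - I₂) * ζ 3 * ζ 4 * ζ 0 * ζ 1 / (I₂ * ζ 3 ^ 2 + I₃ * ζ 4 ^ 2),
    -(2 * l * I₃ * ζ 4 * ζ 0 * ζ 1) / (I₂ * ζ 3 ^ 2 + I₃ * ζ 4 ^ 2),
    ζ 0 * ζ 4,
    -(ζ 0 * ζ 3)]

/-- A solution of the reduced pendulum-skate dynamics: a differentiable curve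
`ζ : ℝ → ℝ⁵` with `ζ' t = f (ζ t)` and `I₂·Γ₂(t)² + I₃·Γ₃(t)² ≠ 0` for all `t`. -/
def IsSkateSol (m g l I₁ I₂ I₃ : ℝ) (ζ : ℝ → Fin 5 → ℝ) : Prop :=
  ∀ t : ℝ, I₂ * ζ t 3 ^ 2 + I₃ * ζ t 4 ^ 2 ≠ 0 ∧
    HasDerivAt ζ (skateF m g l I₁ I₂ I₃ (ζ t)) t

/-- Along every solution of the reduced pendulum-skate dynamics, the quantity
`C₁ = (I₂·Γ₂² + I₃·Γ₃²)·v₂` is constant. -/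
theorem stmt_0 (m g l I₁ I₂ I₃ : ℝ) (hm : 0 < m) (hg : 0 < g) (hl : 0 < l)
    (hI₁ : 0 < I₁) (hI₂ : 0 < I₂) (hI₃ : 0 < I₃)
    (ζ : ℝ → Fin 5 → ℝ) (hζ : IsSkateSol m g l I₁ I₂ I₃ ζ) (t s : ℝ) :
    (I₂ * ζ t 3 ^ 2 + I₃ * ζ t 4 ^ 2) * ζ t 1
      = (I₂ * ζ s 3 ^ 2 + I₃ * ζ s 4 ^ 2) * ζ s 1 := by
  have key : ∀ u, HasDerivAt
      (fun u => (I₂ * ζ u 3 ^ 2 + I₃ * ζ u 4 ^ 2) * ζ u 1) 0 u := by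
    intro u
    obtain ⟨hne, hder⟩ := hζ u
    have hcoord := hasDerivAt_pi.1 hder
    have h1 := hcoord 1
    have h3 := hcoord 3
    have h4 := hcoord 4
    simp only [skateF, Matrix.cons_val] at h1 h3 h4
    refine ((((h3.pow 2).const_mul I₂).add ((h4.pow 2).const_mul I₃)).mul h1).congr_deriv ?_
    simp only [Pi.add_apply, Pi.pow_apply]
    rw [mul_div_cancel₀ _ hne]
    ring
  exact is_const_of_deriv_eq_zero (fun u => (key u).differentiableAt)
    (fun u => (key u).deriv) t s
end

section
/- Assume I₂ > I₃. Let t ↦ ζ(t) = (v₁(t), v₂(t), v₃(t), Γ₂(t), Γ₃(t)) be a solution of the reduced pendulum-skate dynamics ζ' = f(ζ) with Γ₂(0)² + Γ₃(0)² = 1. Then Γ₂(t)² + Γ₃(t)² = 1 for all t, and the quantity C₂(t) := l·Γ₂(t)·v₂(t) + v₃(t) + ( l·C₁ / √(I₃·(I₂ − I₃)) )·arctan( √((I₂ − I₃)/I₃)·Γ₂(t) ) is constant in t, where C₁ is the (constant) value of (I₂·Γ₂(t)² + I₃·Γ₃(t)²)·v₂(t) along the solution. -/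
/-- The vector `(Γ₂, Γ₃)` has constant length along every solution. -/
theorem IsSkateSol.sq_add_sq_eq {m g l I₁ I₂ I₃ : ℝ} {ζ : ℝ → Fin 5 → ℝ}
    (hζ : IsSkateSol m g l I₁ I₂ I₃ ζ) (t s : ℝ) :
    ζ t 3 ^ 2 + ζ t 4 ^ 2 = ζ s 3 ^ 2 + ζ s 4 ^ 2 := by
  have hd (t : ℝ) : HasDerivAt (fun t => ζ t 3 ^ 2 + ζ t 4 ^ 2) 0 t := by
    have h := hasDerivAt_pi.1 (hζ t).2
    have h3 : HasDerivAt (fun t => ζ t 3) (ζ t 0 * ζ t 4) t := h 3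
    have h4 : HasDerivAt (fun t => ζ t 4) (-(ζ t 0 * ζ t 3)) t := h 4
    refine ((h3.fun_pow 2).fun_add (h4.fun_pow 2)).congr_deriv ?_
    push_cast
    ring
  exact is_const_of_deriv_eq_zero (fun t => (hd t).differentiableAt) (fun t => (hd t).deriv) t s

/-- Assume `I₂ > I₃`.  Along every solution of the reduced pendulum-skate dynamics with
`Γ₂(0)² + Γ₃(0)² = 1` one has `Γ₂(t)² + Γ₃(t)² = 1` for all `t`, and the quantity
`C₂ = l·Γ₂·v₂ + v₃ + (l·C₁/√(I₃·(I₂ − I₃)))·arctan(√((I₂ − I₃)/I₃)·Γ₂)` is constant,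
where `C₁` is the constant value of `(I₂·Γ₂² + I₃·Γ₃²)·v₂` along the solution. -/
theorem stmt_2 (m g l I₁ I₂ I₃ : ℝ) (hm : 0 < m) (hg : 0 < g) (hl : 0 < l)
    (hI₁ : 0 < I₁) (hI₂ : 0 < I₂) (hI₃ : 0 < I₃) (hI : I₂ > I₃)
    (ζ : ℝ → Fin 5 → ℝ) (hζ : IsSkateSol m g l I₁ I₂ I₃ ζ)
    (hinit : ζ 0 3 ^ 2 + ζ 0 4 ^ 2 = 1)
    (C₁ : ℝ) (hC₁ : ∀ t : ℝ, (I₂ * ζ t 3 ^ 2 + I₃ * ζ t 4 ^ 2) * ζ t 1 = C₁) :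
    (∀ t : ℝ, ζ t 3 ^ 2 + ζ t 4 ^ 2 = 1) ∧
    (∀ t s : ℝ,
      l * ζ t 3 * ζ t 1 + ζ t 2
        + l * C₁ / Real.sqrt (I₃ * (I₂ - I₃)) * Real.arctan (Real.sqrt ((I₂ - I₃) / I₃) * ζ t 3)
      = l * ζ s 3 * ζ s 1 + ζ s 2
        + l * C₁ / Real.sqrt (I₃ * (I₂ - I₃)) * Real.arctan (Real.sqrt ((I₂ - I₃) / I₃) * ζ s 3)) := by
  have hnorm (t : ℝ) : ζ t 3 ^ 2 + ζ t 4 ^ 2 = 1 := (hζ.sq_add_sq_eq t 0).trans hinit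
  refine ⟨hnorm, ?_⟩
  have hk : 0 < I₂ - I₃ := sub_pos.2 hI
  have hd (t : ℝ) : HasDerivAt (fun t => l * ζ t 3 * ζ t 1 + ζ t 2
      + l * C₁ / Real.sqrt (I₃ * (I₂ - I₃)) *
        Real.arctan (Real.sqrt ((I₂ - I₃) / I₃) * ζ t 3)) 0 t := by
    obtain ⟨hD, h⟩ := hζ t
    replace h := hasDerivAt_pi.1 h
    have h1 : HasDerivAt (fun t => ζ t 1) (2 * (I₃ - I₂) * ζ t 3 * ζ t 4 * ζ t 0 * ζ t 1 /
      (I₂ * ζ t 3 ^ 2 + I₃ * ζ t 4 ^ 2)) t := h 1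
    have h2 : HasDerivAt (fun t => ζ t 2) (-(2 * l * I₃ * ζ t 4 * ζ t 0 * ζ t 1) /
      (I₂ * ζ t 3 ^ 2 + I₃ * ζ t 4 ^ 2)) t := h 2
    have h3 : HasDerivAt (fun t => ζ t 3) (ζ t 0 * ζ t 4) t := h 3
    refine ((((h3.const_mul l).fun_mul h1).fun_add h2).fun_add
      ((h3.const_mul _).arctan.const_mul _)).congr_deriv ?_
    have hDk : I₂ * ζ t 3 ^ 2 + I₃ * ζ t 4 ^ 2 = I₃ + (I₂ - I₃) * ζ t 3 ^ 2 := by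
      linear_combination I₃ * hnorm t
    have hsqrt : Real.sqrt ((I₂ - I₃) / I₃) / Real.sqrt (I₃ * (I₂ - I₃)) = 1 / I₃ := by
      rw [Real.sqrt_div hk.le, Real.sqrt_mul hI₃.le]
      have ha := (Real.sqrt_pos.2 hk).ne'
      have hb := (Real.sqrt_pos.2 hI₃).ne'
      field_simp
      exact (Real.sq_sqrt hI₃.le).symm
    have harctan : l * C₁ / Real.sqrt (I₃ * (I₂ - I₃)) *
        (1 / (1 + (Real.sqrt ((I₂ - I₃) / I₃) * ζ t 3) ^ 2) *
          (Real.sqrt ((I₂ - I₃) / I₃) * (ζ t 0 * ζ t 4))) = l * ζ t 0 * ζ t 1 * ζ t 4 := by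
      have hden : 1 + (Real.sqrt ((I₂ - I₃) / I₃) * ζ t 3) ^ 2 =
          (I₃ + (I₂ - I₃) * ζ t 3 ^ 2) / I₃ := by
        rw [mul_pow, Real.sq_sqrt (div_pos hk hI₃).le]
        field_simp
      calc
        _ = l * C₁ * (Real.sqrt ((I₂ - I₃) / I₃) / Real.sqrt (I₃ * (I₂ - I₃))) *
            (1 / (1 + (Real.sqrt ((I₂ - I₃) / I₃) * ζ t 3) ^ 2)) * (ζ t 0 * ζ t 4) := by ring
        _ = _ := by
          rw [hsqrt, hden, ← hC₁ t, hDk]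
          rw [hDk] at hD
          field_simp
    rw [harctan, hDk]
    rw [hDk] at hD
    field_simp
    ring
  exact is_const_of_deriv_eq_zero (fun t => (hd t).differentiableAt) (fun t => (hd t).deriv)
end

section
/- Let Ω₀ ∈ ℝ and let ζ_sp := (0, Ω₀, 0, 0, 1). The Jacobian matrix Df(ζ_sp) ∈ Matrix (Fin 5) (Fin 5) ℝ of f at ζ_sp has characteristic polynomial X³·(X² − c), where c := (m·g·l − (I₃ + m·l² − I₂)·Ω₀²)/(I₁ + m·l²). In particular, if I₃ + m·l² < I₂ then Df(ζ_sp) has the positive real eigenvalue √c. -/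
/-- The Jacobian matrix of `skateF` at the spinning equilibrium `(0, Ω, 0, 0, 1)`. -/
noncomputable def skateJacobian (m g l I₁ I₂ I₃ Ω : ℝ) : Matrix (Fin 5) (Fin 5) ℝ :=
  !![0, 0, m * l * Ω / (I₁ + m * l ^ 2),
      ((I₂ + m * l ^ 2 - I₃) * Ω ^ 2 + m * g * l) / (I₁ + m * l ^ 2), 0;
    0, 0, 0, 0, 0;
    -(2 * l * Ω), 0, 0, 0, 0;
    1, 0, 0, 0, 0;
    0, 0, 0, 0, 0]

/-- `skateJacobian` is the derivative of `skateF` at the spinning equilibrium. -/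
theorem hasFDerivAt_skateF_spinning (m g l I₁ I₂ I₃ Ω : ℝ) (hI₃ : I₃ ≠ 0) :
    HasFDerivAt (skateF m g l I₁ I₂ I₃)
      (LinearMap.toContinuousLinearMap (skateJacobian m g l I₁ I₂ I₃ Ω).mulVecLin)
      ![0, Ω, 0, 0, 1] := by
  have h (i : Fin 5) : HasFDerivAt (fun ζ : Fin 5 → ℝ => ζ i)
      (ContinuousLinearMap.proj (R := ℝ) (φ := fun _ : Fin 5 => ℝ) i) ![0, Ω, 0, 0, 1] :=
    hasFDerivAt_apply i _
  have hne : I₂ * (![0, Ω, 0, 0, 1] : Fin 5 → ℝ) 3 ^ 2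
      + I₃ * (![0, Ω, 0, 0, 1] : Fin 5 → ℝ) 4 ^ 2 ≠ 0 := by
    simpa using hI₃
  have hden := HasDerivAt.comp_hasFDerivAt (h₂ := fun x : ℝ => x⁻¹)
    (f := fun ζ : Fin 5 → ℝ => I₂ * ζ 3 ^ 2 + I₃ * ζ 4 ^ 2) _ (hasDerivAt_inv hne)
    ((((h 3).pow 2).const_mul I₂).add (((h 4).pow 2).const_mul I₃))
  rw [hasFDerivAt_pi']
  intro i
  fin_cases i
  · refine (((((((h 4).const_mul (I₂ + m * l ^ 2 - I₃)).mul ((h 1).pow 2)).add_const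
      (m * g * l)).mul (h 3)).add ((((h 4).const_mul (m * l)).mul (h 1)).mul (h 2))).mul_const
      (I₁ + m * l ^ 2)⁻¹).congr_fderiv ?_
    ext v
    simp [skateJacobian, dotProduct, Fin.sum_univ_five]
    ring
  · refine (((((h 3).const_mul (2 * (I₃ - I₂))).mul (h 4)).mul (h 0)).mul (h 1)
      |>.mul hden).congr_fderiv ?_
    ext v
    simp [skateJacobian, dotProduct, Fin.sum_univ_five]
  · refine ((((h 4).const_mul (2 * l * I₃)).mul (h 0)).mul (h 1)
      |>.neg.mul hden).congr_fderiv ?_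
    ext v
    simp [skateJacobian, dotProduct, Fin.sum_univ_five]
    field_simp
  · refine ((h 0).mul (h 4)).congr_fderiv ?_
    ext v
    simp [skateJacobian, dotProduct, Fin.sum_univ_five]
  · refine ((h 0).mul (h 3)).neg.congr_fderiv ?_
    ext v
    simp [skateJacobian, dotProduct, Fin.sum_univ_five]

open Polynomial in
theorem skateJacobian_charpoly (m g l I₁ I₂ I₃ Ω : ℝ) :
    (skateJacobian m g l I₁ I₂ I₃ Ω).charpoly
      = X ^ 3 * (X ^ 2
          - C ((m * g * l - (I₃ + m * l ^ 2 - I₂) * Ω ^ 2) / (I₁ + m * l ^ 2))) := by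
  have hc : (m * g * l - (I₃ + m * l ^ 2 - I₂) * Ω ^ 2) / (I₁ + m * l ^ 2)
      = ((I₂ + m * l ^ 2 - I₃) * Ω ^ 2 + m * g * l) / (I₁ + m * l ^ 2)
        + m * l * Ω / (I₁ + m * l ^ 2) * -(2 * l * Ω) := by
    ring
  rw [hc, C_add, C_mul, skateJacobian]
  generalize m * l * Ω / (I₁ + m * l ^ 2) = a
  generalize ((I₂ + m * l ^ 2 - I₃) * Ω ^ 2 + m * g * l) / (I₁ + m * l ^ 2) = b
  generalize -(2 * l * Ω) = d
  simp [Matrix.charpoly, Matrix.charmatrix_apply, Matrix.det_succ_row_zero, Fin.sum_univ_succ,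
    Fin.succAbove, Matrix.diagonal_apply]
  ring

/-- A square root `s` of the constant in the characteristic polynomial is an eigenvalue, with an
explicit eigenvector. -/
theorem skateJacobian_mulVec (m g l I₁ I₂ I₃ Ω s : ℝ)
    (hs : s ^ 2 = (m * g * l - (I₃ + m * l ^ 2 - I₂) * Ω ^ 2) / (I₁ + m * l ^ 2)) :
    (skateJacobian m g l I₁ I₂ I₃ Ω).mulVec ![s, 0, -(2 * l * Ω), 1, 0]
      = s • ![s, 0, -(2 * l * Ω), 1, 0] := by
  ext i
  fin_cases i <;> simp [skateJacobian, Matrix.mulVec, dotProduct, Fin.sum_univ_five]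
  · rw [← sq, hs]
    ring
  · ring

open Polynomial in
/-- The Jacobian matrix `Df(ζ_sp)` of `f` at the spinning equilibrium
`ζ_sp = (0, Ω₀, 0, 0, 1)` has characteristic polynomial `X³·(X² − c)` with
`c = (m·g·l − (I₃ + m·l² − I₂)·Ω₀²)/(I₁ + m·l²)`; in particular, if
`I₃ + m·l² < I₂` then `Df(ζ_sp)` has the positive real eigenvalue `√c`. -/
theorem stmt_5 (m g l I₁ I₂ I₃ : ℝ) (hm : 0 < m) (hg : 0 < g) (hl : 0 < l)
    (hI₁ : 0 < I₁) (hI₂ : 0 < I₂) (hI₃ : 0 < I₃) (Ω₀ : ℝ) :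
    ∃ J : Matrix (Fin 5) (Fin 5) ℝ,
      HasFDerivAt (skateF m g l I₁ I₂ I₃)
        (LinearMap.toContinuousLinearMap J.mulVecLin) ![0, Ω₀, 0, 0, 1] ∧
      J.charpoly
        = X ^ 3 * (X ^ 2
            - C ((m * g * l - (I₃ + m * l ^ 2 - I₂) * Ω₀ ^ 2) / (I₁ + m * l ^ 2))) ∧
      (I₃ + m * l ^ 2 < I₂ →
        0 < Real.sqrt ((m * g * l - (I₃ + m * l ^ 2 - I₂) * Ω₀ ^ 2) / (I₁ + m * l ^ 2)) ∧
        ∃ v : Fin 5 → ℝ, v ≠ 0 ∧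
          J.mulVec v
            = Real.sqrt ((m * g * l - (I₃ + m * l ^ 2 - I₂) * Ω₀ ^ 2) / (I₁ + m * l ^ 2)) • v) := by
  refine ⟨skateJacobian m g l I₁ I₂ I₃ Ω₀, hasFDerivAt_skateF_spinning m g l I₁ I₂ I₃ Ω₀ hI₃.ne',
    skateJacobian_charpoly m g l I₁ I₂ I₃ Ω₀, fun h => ?_⟩
  have hc : 0 < (m * g * l - (I₃ + m * l ^ 2 - I₂) * Ω₀ ^ 2) / (I₁ + m * l ^ 2) := by
    have h₁ : 0 < m * g * l := by positivity
    have h₂ : 0 ≤ (I₂ - (I₃ + m * l ^ 2)) * Ω₀ ^ 2 :=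
      mul_nonneg (sub_nonneg.2 h.le) (sq_nonneg _)
    exact div_pos (by linarith) (by positivity)
  refine ⟨Real.sqrt_pos.2 hc, _, fun hv => ?_,
    skateJacobian_mulVec m g l I₁ I₂ I₃ Ω₀ _ (Real.sq_sqrt hc.le)⟩
  simpa using congrFun hv 3
end

section
/- Assume I₂ > I₃ and let Ω₀ ∈ ℝ, ζ_sp := (0, Ω₀, 0, 0, 1). Define on a neighborhood of ζ_sp in ℝ⁵ the functions ℰ(ζ) := (1/2)·(Ī₁·v₁² + (Ī₂·Γ₂² + I₃·Γ₃²)·v₂² + 2·m·l·Γ₂·v₂·v₃ + m·v₃²) + m·g·l·Γ₃, C₁(ζ) := (I₂·Γ₂² + I₃·Γ₃²)·v₂, C₂(ζ) := l·Γ₂·v₂ + v₃ + ( l·C₁(ζ)/√(I₃·(I₂ − I₃)) )·arctan( √((I₂ − I₃)/I₃)·Γ₂ ), and C₃(ζ) := (Γ₂² + Γ₃²)/2. Then the function V := ℰ − Ω₀·C₁ + (I₃·Ω₀² − m·g·l)·C₃ satisfies DV(ζ_sp) = 0; and if moreover I₃ + m·l² > I₂ and Ω₀² > m·g·l/(I₃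 + m·l² − I₂), then D²V(ζ_sp)(w, w) > 0 for every nonzero w ∈ ℝ⁵ with DC₁(ζ_sp)(w) = DC₂(ζ_sp)(w) = DC₃(ζ_sp)(w) = 0. -/
/-- The constrained energy of the pendulum skate. -/
noncomputable def skateE (m g l I₁ I₂ I₃ : ℝ) (ζ : Fin 5 → ℝ) : ℝ :=
  (1 / 2) * ((I₁ + m * l ^ 2) * ζ 0 ^ 2
      + ((I₂ + m * l ^ 2) * ζ 3 ^ 2 + I₃ * ζ 4 ^ 2) * ζ 1 ^ 2
      + 2 * m * l * ζ 3 * ζ 1 * ζ 2 + m * ζ 2 ^ 2) + m * g * l * ζ 4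

/-- The invariant `C₁ = (I₂·Γ₂² + I₃·Γ₃²)·v₂`. -/
noncomputable def skateC₁ (I₂ I₃ : ℝ) (ζ : Fin 5 → ℝ) : ℝ := (I₂ * ζ 3 ^ 2 + I₃ * ζ 4 ^ 2) * ζ 1

/-- The invariant `C₂ = l·Γ₂·v₂ + v₃ + (l·C₁/√(I₃·(I₂−I₃)))·arctan(√((I₂−I₃)/I₃)·Γ₂)`. -/
noncomputable def skateC₂ (l I₂ I₃ : ℝ) (ζ : Fin 5 → ℝ) : ℝ :=
  l * ζ 3 * ζ 1 + ζ 2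
    + l * skateC₁ I₂ I₃ ζ / Real.sqrt (I₃ * (I₂ - I₃))
      * Real.arctan (Real.sqrt ((I₂ - I₃) / I₃) * ζ 3)

/-- The invariant `C₃ = (Γ₂² + Γ₃²)/2`. -/
noncomputable def skateC₃ (ζ : Fin 5 → ℝ) : ℝ := (ζ 3 ^ 2 + ζ 4 ^ 2) / 2

/-- The augmented energy `V = ℰ − Ω₀·C₁ + (I₃·Ω₀² − m·g·l)·C₃` of the pendulum skate. -/
noncomputable def skateV (m g l I₁ I₂ I₃ Ω₀ : ℝ) (ζ : Fin 5 → ℝ) : ℝ :=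
  skateE m g l I₁ I₂ I₃ ζ - Ω₀ * skateC₁ I₂ I₃ ζ + (I₃ * Ω₀ ^ 2 - m * g * l) * skateC₃ ζ

/-- The directional derivative of `skateV` at `ζ` along `w`. -/
noncomputable def skateV' (m g l I₁ I₂ I₃ Ω₀ : ℝ) (w ζ : Fin 5 → ℝ) : ℝ :=
  (I₁ + m * l ^ 2) * ζ 0 * w 0
    + (((I₂ + m * l ^ 2) * ζ 3 ^ 2 + I₃ * ζ 4 ^ 2) * ζ 1 + m * l * ζ 3 * ζ 2
      - Ω₀ * (I₂ * ζ 3 ^ 2 + I₃ * ζ 4 ^ 2)) * w 1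
    + (m * l * ζ 3 * ζ 1 + m * ζ 2) * w 2
    + ((I₂ + m * l ^ 2) * ζ 3 * ζ 1 ^ 2 + m * l * ζ 1 * ζ 2 - 2 * Ω₀ * I₂ * ζ 3 * ζ 1
      + (I₃ * Ω₀ ^ 2 - m * g * l) * ζ 3) * w 3
    + (I₃ * ζ 4 * ζ 1 ^ 2 + m * g * l - 2 * Ω₀ * I₃ * ζ 4 * ζ 1
      + (I₃ * Ω₀ ^ 2 - m * g * l) * ζ 4) * w 4

lemma hasDerivAt_line_coord {ι : Type*} (ζ w : ι → ℝ) (i : ι) (t : ℝ) :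
    HasDerivAt (fun t : ℝ => (ζ + t • w) i) (w i) t := by
  simpa using ((hasDerivAt_id t).mul_const (w i)).const_add (ζ i)

lemma contDiff_skateV (m g l I₁ I₂ I₃ Ω₀ : ℝ) : ContDiff ℝ 2 (skateV m g l I₁ I₂ I₃ Ω₀) := by
  unfold skateV skateE skateC₁ skateC₃
  fun_prop

lemma fderiv_skateV_apply (m g l I₁ I₂ I₃ Ω₀ : ℝ) (ζ w : Fin 5 → ℝ) :
    fderiv ℝ (skateV m g l I₁ I₂ I₃ Ω₀) ζ w = skateV' m g l I₁ I₂ I₃ Ω₀ w ζ := by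
  have hd : DifferentiableAt ℝ (skateV m g l I₁ I₂ I₃ Ω₀) ζ :=
    (contDiff_skateV m g l I₁ I₂ I₃ Ω₀).differentiable (by norm_num) ζ
  rw [← hd.lineDeriv_eq_fderiv]
  refine HasLineDerivAt.lineDeriv ?_
  have h := fun i => hasDerivAt_line_coord ζ w i 0
  unfold HasLineDerivAt skateV skateE skateC₁ skateC₃
  refine HasDerivAt.congr_deriv ((((((h 0).fun_pow 2).const_mul (I₁ + m * l ^ 2)).fun_add
    (((((h 3).fun_pow 2).const_mul (I₂ + m * l ^ 2)).fun_add
      (((h 4).fun_pow 2).const_mul I₃)).fun_mul ((h 1).fun_pow 2)) |>.fun_add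
    ((((h 3).const_mul (2 * m * l)).fun_mul (h 1)).fun_mul (h 2)) |>.fun_add
    (((h 2).fun_pow 2).const_mul m)).const_mul (1 / 2) |>.fun_add
    ((h 4).const_mul (m * g * l)) |>.fun_sub
    (((((h 3).fun_pow 2).const_mul I₂).fun_add
      (((h 4).fun_pow 2).const_mul I₃)).fun_mul (h 1) |>.const_mul Ω₀) |>.fun_add
    ((((h 3).fun_pow 2).fun_add ((h 4).fun_pow 2)).div_const 2 |>.const_mul
      (I₃ * Ω₀ ^ 2 - m * g * l)))) ?_
  simp [skateV']
  ring

/-- The second derivative of `skateV` at the spinning equilibrium, along directions with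
vanishing second and fifth components. -/
lemma iteratedFDeriv_two_skateV_apply (m g l I₁ I₂ I₃ Ω₀ : ℝ) (w : Fin 5 → ℝ)
    (h1 : w 1 = 0) (h4 : w 4 = 0) :
    iteratedFDeriv ℝ 2 (skateV m g l I₁ I₂ I₃ Ω₀) ![0, Ω₀, 0, 0, 1] ![w, w]
      = (I₁ + m * l ^ 2) * w 0 ^ 2 + 2 * m * l * Ω₀ * w 2 * w 3 + m * w 2 ^ 2
        + ((m * l ^ 2 + I₃ - I₂) * Ω₀ ^ 2 - m * g * l) * w 3 ^ 2 := by
  set ζ₀ : Fin 5 → ℝ := ![0, Ω₀, 0, 0, 1] with hζ₀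
  have hd : DifferentiableAt ℝ (fderiv ℝ (skateV m g l I₁ I₂ I₃ Ω₀)) ζ₀ :=
    ((contDiff_skateV m g l I₁ I₂ I₃ Ω₀).fderiv_right (m := 1) (by norm_num)).differentiable
      (by norm_num) ζ₀
  rw [iteratedFDeriv_two_apply]
  have hc := hd.hasFDerivAt.clm_apply (hasFDerivAt_const w ζ₀)
  have hl := (hc.hasLineDerivAt w).lineDeriv
  simp only [fderiv_skateV_apply] at hl
  simp only [Matrix.cons_val_zero, Matrix.cons_val_one]
  trans lineDeriv ℝ (skateV' m g l I₁ I₂ I₃ Ω₀ w) ζ₀ w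
  · rw [hl]; simp
  refine HasLineDerivAt.lineDeriv ?_
  have h := fun i => hasDerivAt_line_coord ζ₀ w i 0
  unfold HasLineDerivAt skateV'
  simp only [h1, h4, mul_zero, add_zero]
  refine HasDerivAt.congr_deriv (((((h 0).const_mul (I₁ + m * l ^ 2)).mul_const (w 0)).fun_add
    ((((h 3).const_mul (m * l)).fun_mul (h 1)).fun_add ((h 2).const_mul m) |>.mul_const (w 2))
    |>.fun_add
    ((((h 3).const_mul (I₂ + m * l ^ 2)).fun_mul ((h 1).fun_pow 2) |>.fun_add
      (((h 1).const_mul (m * l)).fun_mul (h 2)) |>.fun_sub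
      (((h 3).const_mul (2 * Ω₀ * I₂)).fun_mul (h 1)) |>.fun_add
      ((h 3).const_mul (I₃ * Ω₀ ^ 2 - m * g * l))).mul_const (w 3)))) ?_
  simp [hζ₀, h1]
  ring

lemma fderiv_skateC₁_apply (I₂ I₃ Ω₀ : ℝ) (w : Fin 5 → ℝ) :
    fderiv ℝ (skateC₁ I₂ I₃) ![0, Ω₀, 0, 0, 1] w = I₃ * w 1 + 2 * I₃ * Ω₀ * w 4 := by
  have hd : Differentiable ℝ (skateC₁ I₂ I₃) := by unfold skateC₁; fun_prop
  rw [← (hd _).lineDeriv_eq_fderiv]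
  refine HasLineDerivAt.lineDeriv ?_
  have h := fun i => hasDerivAt_line_coord ![0, Ω₀, 0, 0, 1] w i 0
  unfold HasLineDerivAt skateC₁
  refine HasDerivAt.congr_deriv ((((h 3).fun_pow 2).const_mul I₂).fun_add (((h 4).fun_pow 2).const_mul I₃)
    |>.fun_mul (h 1)) ?_
  simp
  ring

lemma fderiv_skateC₃_apply (Ω₀ : ℝ) (w : Fin 5 → ℝ) :
    fderiv ℝ skateC₃ ![0, Ω₀, 0, 0, 1] w = w 4 := by
  have hd : Differentiable ℝ skateC₃ := by unfold skateC₃; fun_prop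
  rw [← (hd _).lineDeriv_eq_fderiv]
  refine HasLineDerivAt.lineDeriv ?_
  have h := fun i => hasDerivAt_line_coord ![0, Ω₀, 0, 0, 1] w i 0
  unfold HasLineDerivAt skateC₃
  refine HasDerivAt.congr_deriv (((h 3).fun_pow 2).fun_add ((h 4).fun_pow 2) |>.div_const 2) ?_
  simp

lemma fderiv_skateC₂_apply (l Ω₀ : ℝ) {I₂ I₃ : ℝ} (hI₃ : 0 < I₃) (h23 : I₃ < I₂)
    (w : Fin 5 → ℝ) :
    fderiv ℝ (skateC₂ l I₂ I₃) ![0, Ω₀, 0, 0, 1] w = w 2 + 2 * l * Ω₀ * w 3 := by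
  have hd₁ : Differentiable ℝ (skateC₁ I₂ I₃) := by unfold skateC₁; fun_prop
  have hd : Differentiable ℝ (skateC₂ l I₂ I₃) :=
    Differentiable.add (by fun_prop) (.mul (by fun_prop) (.arctan (by fun_prop)))
  rw [← (hd _).lineDeriv_eq_fderiv]
  refine HasLineDerivAt.lineDeriv ?_
  have h := fun i => hasDerivAt_line_coord ![0, Ω₀, 0, 0, 1] w i 0
  have hC := (hd₁ ![0, Ω₀, 0, 0, 1]).hasFDerivAt.hasLineDerivAt w
  unfold HasLineDerivAt at hC ⊢
  unfold skateC₂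
  have hsqrt : √((I₂ - I₃) / I₃) = √(I₃ * (I₂ - I₃)) / I₃ := by
    rw [Real.sqrt_eq_iff_mul_self_eq (div_nonneg (by linarith) hI₃.le) (by positivity),
      div_mul_div_comm, Real.mul_self_sqrt (mul_nonneg hI₃.le (by linarith))]
    field_simp
  have hpos : 0 < √(I₃ * (I₂ - I₃)) := Real.sqrt_pos.2 (mul_pos hI₃ (by linarith))
  refine HasDerivAt.congr_deriv ((((h 3).const_mul l).fun_mul (h 1)).fun_add (h 2) |>.fun_add
    (((hC.const_mul l).div_const √(I₃ * (I₂ - I₃))).fun_mul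
      ((h 3).const_mul √((I₂ - I₃) / I₃)).arctan)) ?_
  simp [skateC₁, hsqrt]
  field_simp
  ring

/-- At the spinning equilibrium `ζ_sp = (0, Ω₀, 0, 0, 1)`, the function
`V = ℰ − Ω₀·C₁ + (I₃·Ω₀² − m·g·l)·C₃` has vanishing derivative, and its second-derivative
quadratic form is positive definite on the joint kernel of `DC₁`, `DC₂`, `DC₃` at `ζ_sp`
provided `I₃ + m·l² > I₂` and `Ω₀² > m·g·l/(I₃ + m·l² − I₂)`. -/
theorem stmt_8 (m g l I₁ I₂ I₃ : ℝ) (hm : 0 < m) (hg : 0 < g) (hl : 0 < l)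
    (hI₁ : 0 < I₁) (hI₂ : 0 < I₂) (hI₃ : 0 < I₃) (h23 : I₂ > I₃) (Ω₀ : ℝ) :
    fderiv ℝ (fun ζ => skateE m g l I₁ I₂ I₃ ζ - Ω₀ * skateC₁ I₂ I₃ ζ
        + (I₃ * Ω₀ ^ 2 - m * g * l) * skateC₃ ζ) ![0, Ω₀, 0, 0, 1] = 0 ∧
    (I₃ + m * l ^ 2 > I₂ → Ω₀ ^ 2 > m * g * l / (I₃ + m * l ^ 2 - I₂) →
      ∀ w : Fin 5 → ℝ, w ≠ 0 →
        fderiv ℝ (skateC₁ I₂ I₃) ![0, Ω₀, 0, 0, 1] w = 0 →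
        fderiv ℝ (skateC₂ l I₂ I₃) ![0, Ω₀, 0, 0, 1] w = 0 →
        fderiv ℝ skateC₃ ![0, Ω₀, 0, 0, 1] w = 0 →
        0 < iteratedFDeriv ℝ 2
            (fun ζ => skateE m g l I₁ I₂ I₃ ζ - Ω₀ * skateC₁ I₂ I₃ ζ
              + (I₃ * Ω₀ ^ 2 - m * g * l) * skateC₃ ζ) ![0, Ω₀, 0, 0, 1] ![w, w]) := by
  change fderiv ℝ (skateV m g l I₁ I₂ I₃ Ω₀) _ = 0 ∧ (_ → _ → ∀ w, _ → _ → _ → _ →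
    0 < iteratedFDeriv ℝ 2 (skateV m g l I₁ I₂ I₃ Ω₀) _ _)
  refine ⟨?_, fun hI hΩ w hw hC₁ hC₂ hC₃ => ?_⟩
  · ext1 w
    rw [fderiv_skateV_apply]
    simp [skateV']
    ring
  rw [fderiv_skateC₃_apply] at hC₃
  rw [fderiv_skateC₁_apply, hC₃, mul_zero, add_zero, mul_eq_zero_iff_left hI₃.ne'] at hC₁
  rw [fderiv_skateC₂_apply l Ω₀ hI₃ h23] at hC₂
  have h2 : w 2 = -(2 * l * Ω₀ * w 3) := by linarith
  rw [iteratedFDeriv_two_skateV_apply m g l I₁ I₂ I₃ Ω₀ w hC₁ hC₃, h2]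
  rw [gt_iff_lt, div_lt_iff₀ (by linarith)] at hΩ
  have hA : 0 < I₁ + m * l ^ 2 := by positivity
  have hB : 0 < (I₃ + m * l ^ 2 - I₂) * Ω₀ ^ 2 - m * g * l := by linarith
  suffices 0 < (I₁ + m * l ^ 2) * w 0 ^ 2
      + ((I₃ + m * l ^ 2 - I₂) * Ω₀ ^ 2 - m * g * l) * w 3 ^ 2 by
    linear_combination this
  by_cases h0 : w 0 = 0
  · have h3 : w 3 ≠ 0 := by
      rintro h3
      refine hw (funext fun i => ?_)
      fin_cases i <;> simp [h0, hC₁, h2, h3, hC₃]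
    positivity
  · positivity
end

section
/- (Proposition 5.2.) Let Y₀ ∈ ℝ and let ζ_sl := (0, 0, Y₀, 0, 1). The Jacobian matrix Df(ζ_sl) ∈ Matrix (Fin 5) (Fin 5) ℝ of f at ζ_sl has characteristic polynomial X³·(X² − m·g·l/(I₁ + m·l²)); in particular Df(ζ_sl) has the positive real eigenvalue √( m·g·l/(I₁ + m·l²) ), so the sliding equilibrium ζ_sl is linearly unstable. -/
/-- The Jacobian matrix of `skateF` at the sliding equilibrium `(0, 0, Y₀, 0, 1)`. -/
noncomputable def slidingJacobian (m g l I₁ Y₀ : ℝ) : Matrix (Fin 5) (Fin 5) ℝ :=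
  !![0, m * l * Y₀ / (I₁ + m * l ^ 2), 0, m * g * l / (I₁ + m * l ^ 2), 0;
     0, 0, 0, 0, 0;
     0, 0, 0, 0, 0;
     1, 0, 0, 0, 0;
     0, 0, 0, 0, 0]

theorem hasFDerivAt_skateF_sliding (m g l I₁ I₂ I₃ : ℝ) (hI₃ : I₃ ≠ 0) (Y₀ : ℝ) :
    HasFDerivAt (skateF m g l I₁ I₂ I₃)
      (LinearMap.toContinuousLinearMap (slidingJacobian m g l I₁ Y₀).mulVecLin)
      ![0, 0, Y₀, 0, 1] := by
  have p (i : Fin 5) : HasFDerivAt (fun ζ : Fin 5 → ℝ => ζ i)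
      (ContinuousLinearMap.proj (R := ℝ) (φ := fun _ : Fin 5 => ℝ) i) ![0, 0, Y₀, 0, 1] :=
    hasFDerivAt_apply i _
  have hden : HasFDerivAt (fun ζ : Fin 5 → ℝ => I₂ * ζ 3 ^ 2 + I₃ * ζ 4 ^ 2) _
      ![0, 0, Y₀, 0, 1] :=
    (((p 3).pow 2).const_mul I₂).fun_add (((p 4).pow 2).const_mul I₃)
  have hne : I₂ * (![0, 0, Y₀, 0, 1] : Fin 5 → ℝ) 3 ^ 2 +
      I₃ * (![0, 0, Y₀, 0, 1] : Fin 5 → ℝ) 4 ^ 2 ≠ 0 := by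
    simpa using hI₃
  have hinv := (hasDerivAt_inv hne).comp_hasFDerivAt (![0, 0, Y₀, 0, 1] : Fin 5 → ℝ) hden
  rw [hasFDerivAt_pi']
  intro i
  fin_cases i
  · refine (((((((p 4).const_mul (I₂ + m * l ^ 2 - I₃)).fun_mul ((p 1).pow 2)).add_const
      (m * g * l)).fun_mul (p 3)).fun_add ((((p 4).const_mul (m * l)).fun_mul (p 1)).fun_mul
      (p 2))).mul_const (I₁ + m * l ^ 2)⁻¹).congr_fderiv ?_
    ext v
    simp [slidingJacobian, dotProduct, Fin.sum_univ_five]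
    ring
  · refine ((((((p 3).const_mul (2 * (I₃ - I₂))).fun_mul (p 4)).fun_mul (p 0)).fun_mul
      (p 1)).fun_mul hinv).congr_fderiv ?_
    ext v
    simp [slidingJacobian, dotProduct, Fin.sum_univ_five]
  · refine (((((p 4).const_mul (2 * l * I₃)).fun_mul (p 0)).fun_mul
      (p 1)).fun_neg.fun_mul hinv).congr_fderiv ?_
    ext v
    simp [slidingJacobian, dotProduct, Fin.sum_univ_five]
  · refine ((p 0).fun_mul (p 4)).congr_fderiv ?_
    ext v
    simp [slidingJacobian, dotProduct, Fin.sum_univ_five]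
  · refine ((p 0).fun_mul (p 3)).fun_neg.congr_fderiv ?_
    ext v
    simp [slidingJacobian, dotProduct, Fin.sum_univ_five]

open Polynomial in
theorem charpoly_slidingJacobian (m g l I₁ Y₀ : ℝ) :
    (slidingJacobian m g l I₁ Y₀).charpoly =
      X ^ 3 * (X ^ 2 - C (m * g * l / (I₁ + m * l ^ 2))) := by
  rw [Matrix.charpoly, slidingJacobian]
  generalize m * g * l / (I₁ + m * l ^ 2) = a
  generalize m * l * Y₀ / (I₁ + m * l ^ 2) = b
  simp [Matrix.det_succ_row_zero, Matrix.charmatrix_apply, Fin.sum_univ_succ, Fin.succAbove,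
    Matrix.diagonal_apply]
  ring

theorem slidingJacobian_mulVec (m g l I₁ Y₀ : ℝ) {s : ℝ}
    (hs : s * s = m * g * l / (I₁ + m * l ^ 2)) :
    (slidingJacobian m g l I₁ Y₀).mulVec ![s, 0, 0, 1, 0] = s • ![s, 0, 0, 1, 0] := by
  ext i
  fin_cases i <;> simp [slidingJacobian, Matrix.mulVec, dotProduct, Fin.sum_univ_five, hs]

open Polynomial in
/-- The Jacobian matrix `Df(ζ_sl)` of `f` at the sliding equilibrium
`ζ_sl = (0, 0, Y₀, 0, 1)` has characteristic polynomial
`X³·(X² − m·g·l/(I₁ + m·l²))`; in particular it has the positive real eigenvalue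
`√(m·g·l/(I₁ + m·l²))`, so the sliding equilibrium is linearly unstable. -/
theorem stmt_9 (m g l I₁ I₂ I₃ : ℝ) (hm : 0 < m) (hg : 0 < g) (hl : 0 < l)
    (hI₁ : 0 < I₁) (hI₂ : 0 < I₂) (hI₃ : 0 < I₃) (Y₀ : ℝ) :
    ∃ J : Matrix (Fin 5) (Fin 5) ℝ,
      HasFDerivAt (skateF m g l I₁ I₂ I₃)
        (LinearMap.toContinuousLinearMap J.mulVecLin) ![0, 0, Y₀, 0, 1] ∧
      J.charpoly = X ^ 3 * (X ^ 2 - C (m * g * l / (I₁ + m * l ^ 2))) ∧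
      0 < Real.sqrt (m * g * l / (I₁ + m * l ^ 2)) ∧
      ∃ v : Fin 5 → ℝ, v ≠ 0 ∧
        J.mulVec v = Real.sqrt (m * g * l / (I₁ + m * l ^ 2)) • v := by
  have ha : 0 < m * g * l / (I₁ + m * l ^ 2) := by positivity
  refine ⟨slidingJacobian m g l I₁ Y₀, hasFDerivAt_skateF_sliding m g l I₁ I₂ I₃ hI₃.ne' Y₀,
    charpoly_slidingJacobian m g l I₁ Y₀, Real.sqrt_pos.2 ha, _, fun h => ?_,
    slidingJacobian_mulVec m g l I₁ Y₀ (Real.mul_self_sqrt ha.le)⟩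
  simpa using congrFun h 3
end

section
/- (Elimination of Lagrange multipliers for the pendulum skate.) Let Ω, Y, Γ : ℝ → ℝ³ be differentiable curves and λ₁, λ₂, λ₃ : ℝ → ℝ functions such that for all t: (1) d/dt( Ī·Ω + m·l·(E₃ × Y) ) = (Ī·Ω + m·l·(E₃ × Y)) × Ω + (m·l·(Ω × E₃) + m·Y) × Y + (−m·g·l·E₃) × Γ + λ₁·(E₁ × Γ); (2) d/dt( m·l·(Ω × E₃) + m·Y ) = (m·l·(Ω × E₃) + m·Y) × Ω + λ₂·Γ + λ₃·(E₁ × Γ); (3) Γ' = Γ × Ω; together with the constraints Γ·E₁ = 0, ‖Γ‖ = 1, Ω·(E₁ × Γ) = 0, Y·Γ = 0, and Y·(E₁ × Γ) = 0, where Ī := diag(I₁ + m·l², I₂ + m·l², I₃). Then the curve ζ(t) := ( Ω(t)·E₁, Ω(t)·Γ(t), Y(t)·E₁, Γ(t)·E₂, Γ(t)·E₃ ) is a solution of the reduced pendulum-skate dynamics ζ' = f(ζ). -/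
/-- Cross product on `ℝ³`. -/
def cross3 (a b : Fin 3 → ℝ) : Fin 3 → ℝ :=
  ![a 1 * b 2 - a 2 * b 1, a 2 * b 0 - a 0 * b 2, a 0 * b 1 - a 1 * b 0]

/-- Dot product on `ℝ³`. -/
def dot3 (a b : Fin 3 → ℝ) : ℝ := a 0 * b 0 + a 1 * b 1 + a 2 * b 2

/-- The standard basis vectors of `ℝ³`. -/
def bE1 : Fin 3 → ℝ := ![1, 0, 0]
def bE2 : Fin 3 → ℝ := ![0, 1, 0]
def bE3 : Fin 3 → ℝ := ![0, 0, 1]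

/-- Elimination of the Lagrange multipliers for the pendulum skate: any solution of the
nonholonomic Euler–Poincaré equations with multipliers, subject to the constraints, gives
rise to a solution `ζ = (Ω·E₁, Ω·Γ, Y·E₁, Γ·E₂, Γ·E₃)` of the reduced dynamics
`ζ' = f(ζ)`. -/
theorem stmt_10 (m g l I₁ I₂ I₃ : ℝ) (hm : 0 < m) (hg : 0 < g) (hl : 0 < l)
    (hI₁ : 0 < I₁) (hI₂ : 0 < I₂) (hI₃ : 0 < I₃)
    (Ω Y Γ : ℝ → Fin 3 → ℝ) (lam₁ lam₂ lam₃ : ℝ → ℝ)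
    (hΩ : Differentiable ℝ Ω) (hY : Differentiable ℝ Y) (hΓ : Differentiable ℝ Γ)
    (h1 : ∀ t, HasDerivAt
      (fun u => (Matrix.diagonal ![I₁ + m * l ^ 2, I₂ + m * l ^ 2, I₃]).mulVec (Ω u)
        + (m * l) • cross3 bE3 (Y u))
      (cross3 ((Matrix.diagonal ![I₁ + m * l ^ 2, I₂ + m * l ^ 2, I₃]).mulVec (Ω t)
          + (m * l) • cross3 bE3 (Y t)) (Ω t)
        + cross3 ((m * l) • cross3 (Ω t) bE3 + m • Y t) (Y t)
        + cross3 ((-(m * g * l)) • bE3) (Γ t)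
        + lam₁ t • cross3 bE1 (Γ t)) t)
    (h2 : ∀ t, HasDerivAt (fun u => (m * l) • cross3 (Ω u) bE3 + m • Y u)
      (cross3 ((m * l) • cross3 (Ω t) bE3 + m • Y t) (Ω t)
        + lam₂ t • Γ t + lam₃ t • cross3 bE1 (Γ t)) t)
    (h3 : ∀ t, HasDerivAt Γ (cross3 (Γ t) (Ω t)) t)
    (hc1 : ∀ t, dot3 (Γ t) bE1 = 0)
    (hc2 : ∀ t, dot3 (Γ t) (Γ t) = 1)
    (hc3 : ∀ t, dot3 (Ω t) (cross3 bE1 (Γ t)) = 0)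
    (hc4 : ∀ t, dot3 (Y t) (Γ t) = 0)
    (hc5 : ∀ t, dot3 (Y t) (cross3 bE1 (Γ t)) = 0) :
    ∀ t : ℝ,
      I₂ * dot3 (Γ t) bE2 ^ 2 + I₃ * dot3 (Γ t) bE3 ^ 2 ≠ 0 ∧
      HasDerivAt
        (fun u => (![dot3 (Ω u) bE1, dot3 (Ω u) (Γ u), dot3 (Y u) bE1,
          dot3 (Γ u) bE2, dot3 (Γ u) bE3] : Fin 5 → ℝ))
        (skateF m g l I₁ I₂ I₃
          ![dot3 (Ω t) bE1, dot3 (Ω t) (Γ t), dot3 (Y t) bE1,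
            dot3 (Γ t) bE2, dot3 (Γ t) bE3]) t := by
  have hΓ0 : ∀ t, Γ t 0 = 0 := fun t => by simpa [dot3, bE1] using hc1 t
  have hn : ∀ t, Γ t 1 ^ 2 + Γ t 2 ^ 2 = 1 := fun t => by
    have := hc2 t
    simp only [dot3, hΓ0] at this
    linarith
  have hΩΓ : ∀ t, Ω t 2 * Γ t 1 = Ω t 1 * Γ t 2 := fun t => by
    have := hc3 t
    simp [dot3, cross3, bE1] at this
    linarith
  have hY4 : ∀ t, Y t 1 * Γ t 1 + Y t 2 * Γ t 2 = 0 := fun t => by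
    have := hc4 t
    simp only [dot3, hΓ0] at this
    linarith
  have hY5 : ∀ t, Y t 2 * Γ t 1 - Y t 1 * Γ t 2 = 0 := fun t => by
    have := hc5 t
    simp [dot3, cross3, bE1] at this
    linarith
  have hY1 : ∀ t, Y t 1 = 0 := fun t => by
    linear_combination Γ t 1 * hY4 t - Γ t 2 * hY5 t - Y t 1 * hn t
  have hY2 : ∀ t, Y t 2 = 0 := fun t => by
    linear_combination Γ t 2 * hY4 t + Γ t 1 * hY5 t - Y t 2 * hn t
  have hs : ∀ t, dot3 (Ω t) (Γ t) = Ω t 1 * Γ t 1 + Ω t 2 * Γ t 2 := fun t => by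
    simp [dot3, hΓ0]
  have hΩ1 : ∀ t, Ω t 1 = dot3 (Ω t) (Γ t) * Γ t 1 := fun t => by
    rw [hs]
    linear_combination -Ω t 1 * hn t - Γ t 2 * hΩΓ t
  have hΩ2 : ∀ t, Ω t 2 = dot3 (Ω t) (Γ t) * Γ t 2 := fun t => by
    rw [hs]
    linear_combination -Ω t 2 * hn t + Γ t 1 * hΩΓ t
  intro t
  have dΩ := fun i => hasDerivAt_pi.1 (hΩ t).hasDerivAt i
  have dY := fun i => hasDerivAt_pi.1 (hY t).hasDerivAt i
  have dΓ1 : HasDerivAt (fun u => Γ u 1) (Ω t 0 * Γ t 2) t := by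
    have := hasDerivAt_pi.1 (h3 t) 1
    simpa [cross3, hΓ0, mul_comm] using this
  have dΓ2 : HasDerivAt (fun u => Γ u 2) (-(Ω t 0 * Γ t 1)) t := by
    have := hasDerivAt_pi.1 (h3 t) 2
    simpa [cross3, hΓ0, mul_comm] using this
  obtain ⟨σ, dσ⟩ : ∃ σ, HasDerivAt (fun u => dot3 (Ω u) (Γ u)) σ t := by
    simp only [hs]
    exact ⟨_, ((dΩ 1).mul dΓ1).add ((dΩ 2).mul dΓ2)⟩
  have eΩ1 := (dΩ 1).unique ((dσ.mul dΓ1).congr_of_eventuallyEq (.of_forall hΩ1))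
  have eΩ2 := (dΩ 2).unique ((dσ.mul dΓ2).congr_of_eventuallyEq (.of_forall hΩ2))
  have eY1 := (dY 1).unique
    ((hasDerivAt_const t (0 : ℝ)).congr_of_eventuallyEq (.of_forall hY1))
  have e10 := (hasDerivAt_pi.1 (h1 t) 0).unique
    ((((dΩ 0).const_mul (I₁ + m * l ^ 2)).sub ((dY 1).const_mul (m * l))).congr_of_eventuallyEq
      (.of_forall fun u => by
        simp [cross3, bE3, Matrix.mulVec_diagonal]; ring))
  have e11 := (hasDerivAt_pi.1 (h1 t) 1).unique
    ((((dΩ 1).const_mul (I₂ + m * l ^ 2)).add ((dY 0).const_mul (m * l))).congr_of_eventuallyEq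
      (.of_forall fun u => by
        simp [cross3, bE3, Matrix.mulVec_diagonal]))
  have e12 := (hasDerivAt_pi.1 (h1 t) 2).unique
    (((dΩ 2).const_mul I₃).congr_of_eventuallyEq
      (.of_forall fun u => by
        simp [cross3, bE3, Matrix.mulVec_diagonal]))
  have e20 := (hasDerivAt_pi.1 (h2 t) 0).unique
    ((((dΩ 1).const_mul (m * l)).add ((dY 0).const_mul m)).congr_of_eventuallyEq
      (.of_forall fun u => by
        simp [cross3, bE3]))
  simp [cross3, bE1, bE3, Matrix.mulVec_diagonal, Matrix.vecHead, hΓ0, hY1, hY2] at e10 e11 e12 e20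
  rw [eY1] at e10
  rw [eΩ1] at e11 e20
  rw [eΩ2] at e12
  rw [hΩ1 t, hΩ2 t] at e10
  rw [hΩ1 t] at e12
  rw [hΩ2 t] at e11 e20
  have eY0 : deriv Y t 0 =
      -(l * (σ * Γ t 1 + 2 * dot3 (Ω t) (Γ t) * Ω t 0 * Γ t 2)) := by
    apply mul_left_cancel₀ hm.ne'
    linear_combination -e20
  rw [eY0] at e11
  have eσ : σ * (I₂ * Γ t 1 ^ 2 + I₃ * Γ t 2 ^ 2) =
      2 * (I₃ - I₂) * Γ t 1 * Γ t 2 * Ω t 0 * dot3 (Ω t) (Γ t) := by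
    linear_combination -Γ t 1 * e11 - Γ t 2 * e12
  have hI₁' : I₁ + m * l ^ 2 ≠ 0 := by positivity
  have hD : I₂ * Γ t 1 ^ 2 + I₃ * Γ t 2 ^ 2 ≠ 0 := by
    refine ne_of_gt ?_
    by_cases h : Γ t 1 = 0
    · have h' : Γ t 2 ^ 2 = 1 := by simpa [h] using hn t
      rw [h, h']
      linarith
    · positivity
  have hE1 : ∀ v : Fin 3 → ℝ, dot3 v bE1 = v 0 := fun v => by simp [dot3, bE1]
  have hE2 : ∀ v : Fin 3 → ℝ, dot3 v bE2 = v 1 := fun v => by simp [dot3, bE2]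
  have hE3 : ∀ v : Fin 3 → ℝ, dot3 v bE3 = v 2 := fun v => by simp [dot3, bE3]
  simp only [hE1, hE2, hE3]
  refine ⟨hD, hasDerivAt_pi.2 fun i => ?_⟩
  fin_cases i
  · refine (dΩ 0).congr_deriv ?_
    simp only [skateF, Fin.zero_eta, Matrix.cons_val]
    rw [eq_div_iff hI₁']
    linear_combination -e10
  · refine dσ.congr_deriv ?_
    simp only [skateF, Fin.mk_one, Matrix.cons_val]
    rw [eq_div_iff hD]
    linear_combination eσ
  · refine (dY 0).congr_deriv ?_
    simp only [skateF, Fin.reduceFinMk, Matrix.cons_val]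
    rw [eq_div_iff hD, eY0]
    linear_combination -l * Γ t 1 * eσ
      - 2 * l * I₃ * Γ t 2 * Ω t 0 * dot3 (Ω t) (Γ t) * hn t
  · exact dΓ1
  · exact dΓ2
end

section
/- (Energy–Casimir theorem.) Let n ≥ 1, let f : ℝⁿ → ℝⁿ be locally Lipschitz, and let ζ₀ ∈ ℝⁿ with f(ζ₀) = 0. Let k ≥ 1 and let ℰ, C₁, …, C_k : ℝⁿ → ℝ be C² functions, each constant along every solution of ζ' = f(ζ), such that the derivatives DC₁(ζ₀), …, DC_k(ζ₀) are linearly independent. Suppose there exist c₁, …, c_k ∈ ℝ such that V := ℰ + c₁·C₁ + … + c_k·C_k satisfies DV(ζ₀) = 0 and such that the quadratic form w ↦ D²V(ζ₀)(w, w) is positive definite, or negative definite, on the subspace { w ∈ ℝⁿ : DC_j(ζ₀)(w) = 0 for all j = 1, …, k }. Then ζ₀ is Lyapunov stable: for every ε > 0 there exists δ > 0 such that every solution ζ : [0, T) → ℝⁿ of ζ' = f(ζ) with ‖ζ(0) − ζ₀‖ < δ satisfies ‖ζ(t) − ζ₀‖ < ε for all t ∈ [0, T). -/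
open Filter Topology Set

/-- If a continuous map `Q` takes the value `Q x₀` near `x₀` only at `x₀`, then continuous curves
in the level sets of `Q` that start close to `x₀` stay close to `x₀`. -/
theorem stable_of_isolated_in_level_set {X F : Type*} [NormedAddCommGroup X] [ProperSpace X]
    [NormedAddCommGroup F] {Q : X → F} (hQ : Continuous Q) {x₀ : X}
    (hiso : ∀ᶠ x in 𝓝 x₀, Q x = Q x₀ → x = x₀) {ε : ℝ} (hε : 0 < ε) :
    ∃ δ > (0 : ℝ), ∀ (T : ℝ) (ζ : ℝ → X), ContinuousOn ζ (Ico 0 T) →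
      (∀ t ∈ Ico 0 T, Q (ζ t) = Q (ζ 0)) → ‖ζ 0 - x₀‖ < δ →
      ∀ t ∈ Ico 0 T, ‖ζ t - x₀‖ < ε := by
  obtain ⟨r, hr, hball⟩ := Metric.eventually_nhds_iff.1 hiso
  obtain ⟨ρ, hρ, hρm⟩ := exists_between (lt_min hr hε)
  obtain ⟨hρr, hρε⟩ := lt_min_iff.1 hρm
  have hG : Continuous fun x => ‖Q x - Q x₀‖ := (hQ.sub continuous_const).norm
  obtain ⟨m, hm, hmin⟩ := (isCompact_sphere x₀ ρ).exists_forall_le' (a := 0) hG.continuousOn (by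
    intro x hx
    rw [norm_pos_iff, sub_ne_zero]
    intro h
    have hdist : dist x x₀ = ρ := hx
    have := hball (hdist.trans_lt hρr) h
    rw [this, dist_self] at hdist
    exact hρ.ne hdist)
  have hsmall : ∀ᶠ x in 𝓝 x₀, ‖Q x - Q x₀‖ < m :=
    hG.continuousAt.eventually_lt continuousAt_const (by simpa using hm)
  obtain ⟨δ, hδ, hδm⟩ := Metric.eventually_nhds_iff.1 hsmall
  refine ⟨min δ ρ, lt_min hδ hρ, fun T ζ hζ hinv h0 t ht => ?_⟩
  obtain ⟨h0δ, h0ρ⟩ := lt_min_iff.1 h0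
  by_contra! hcon
  have hsub : Icc 0 t ⊆ Ico 0 T := fun s hs => ⟨hs.1, hs.2.trans_lt ht.2⟩
  obtain ⟨s, hs, hsρ⟩ := intermediate_value_Icc ht.1
    ((hζ.mono hsub).sub continuousOn_const).norm ⟨h0ρ.le, hρε.le.trans hcon⟩
  have h1 := hmin (ζ s) (by simpa [dist_eq_norm] using hsρ)
  have h2 := hδm (by simpa [dist_eq_norm] using h0δ)
  rw [hinv s (hsub hs)] at h1
  exact h1.not_gt h2

/-- If `x₀` is a critical point of `V` and the Hessian of `V` at `x₀` does not vanish on nonzero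
vectors of `ker L`, where `L` is the derivative of `P` at `x₀`, then `x₀` is isolated in the
common level set of `V` and `P`. -/
theorem isolated_in_level_set_of_hessian_ne_zero {X F : Type*} [NormedAddCommGroup X]
    [NormedSpace ℝ X] [ProperSpace X] [NormedAddCommGroup F] [NormedSpace ℝ F]
    {V : X → ℝ} {P : X → F} {x₀ : X} {B : X →L[ℝ] X →L[ℝ] ℝ} {L : X →L[ℝ] F}
    (hV : Differentiable ℝ V) (hcrit : fderiv ℝ V x₀ = 0)
    (hB : HasFDerivAt (fderiv ℝ V) B x₀) (hP : HasFDerivAt P L x₀)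
    (hne : ∀ w, w ≠ 0 → L w = 0 → B w w ≠ 0) :
    ∀ᶠ x in 𝓝 x₀, V x = V x₀ → P x = P x₀ → x = x₀ := by
  have hcont : Continuous fun w => |B w w| + ‖L w‖ := by fun_prop
  obtain ⟨m, hm, hmin⟩ := (isCompact_sphere (0 : X) 1).exists_forall_le' (a := 0)
    hcont.continuousOn (by
      intro w hw
      have hw0 : w ≠ 0 := by
        rintro rfl
        simp at hw
      by_cases hL : L w = 0
      · have := abs_pos.2 (hne w hw0 hL)
        positivity
      · have := norm_pos_iff.2 hL
        positivity)
  have hη : 0 < m / 3 := by positivity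
  obtain ⟨r, hr, hball⟩ := Metric.eventually_nhds_iff.1 (hB.isLittleO.def hη)
  filter_upwards [hP.isLittleO.def hη, Metric.ball_mem_nhds x₀ hr] with x hx hxr hVx hPx
  by_contra hxne
  obtain ⟨h, rfl⟩ : ∃ h, x = x₀ + h := ⟨x - x₀, by abel⟩
  have hh : h ≠ 0 := by
    rintro rfl
    simp at hxne
  have hpos : 0 < ‖h‖ := norm_pos_iff.2 hh
  have hhr : ‖h‖ < r := by simpa using hxr
  have hLh : ‖L h‖ ≤ m / 3 * ‖h‖ := by simpa [hPx] using hx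
  have hline : ∀ t : ℝ, HasDerivAt (fun t : ℝ => V (x₀ + t • h)) (fderiv ℝ V (x₀ + t • h) h) t := by
    intro t
    have h1 : HasDerivAt (fun t : ℝ => x₀ + t • h) h t := by
      simpa using ((hasDerivAt_id t).smul_const h).const_add x₀
    exact (hV _).hasFDerivAt.comp_hasDerivAt t h1
  obtain ⟨t, ht, hroll⟩ := exists_hasDerivAt_eq_zero (zero_lt_one' ℝ)
    (fun t _ => (hline t).continuousAt.continuousWithinAt) (by simp [hVx]) (fun t _ => hline t)
  have hth : ‖t • h‖ = t * ‖h‖ := by rw [norm_smul, Real.norm_of_nonneg ht.1.le]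
  have hBt := hball (y := x₀ + t • h) (by
    rw [dist_self_add_left, hth]
    nlinarith [ht.2])
  have hBh : |B h h| ≤ m / 3 * ‖h‖ ^ 2 := by
    have h1 := ContinuousLinearMap.le_of_opNorm_le _ hBt h
    simp only [hcrit, add_sub_cancel_left, sub_zero, map_smul, sub_apply,
      hroll, zero_sub, norm_neg, smul_apply, hth, norm_smul,
      Real.norm_eq_abs, abs_of_pos ht.1] at h1
    have h2 : t * |B h h| ≤ t * (m / 3 * ‖h‖ ^ 2) := by linarith
    exact le_of_mul_le_mul_left h2 ht.1
  have hunit := hmin (‖h‖⁻¹ • h) (by simp [norm_smul, hpos.ne'])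
  have hscale : |B (‖h‖⁻¹ • h) (‖h‖⁻¹ • h)| + ‖L (‖h‖⁻¹ • h)‖
      = |B h h| / ‖h‖ ^ 2 + ‖L h‖ / ‖h‖ := by
    simp only [map_smul, smul_apply, smul_eq_mul, abs_mul, norm_smul,
      norm_inv, norm_norm, abs_inv, abs_norm]
    field_simp
  have h1 : |B h h| / ‖h‖ ^ 2 ≤ m / 3 := (div_le_iff₀ (by positivity)).2 hBh
  have h2 : ‖L h‖ / ‖h‖ ≤ m / 3 := (div_le_iff₀ hpos).2 hLh
  linarith


/-- Energy–Casimir theorem: if `f` is locally Lipschitz with equilibrium `ζ₀`, the `C²`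
functions `ℰ, C₁, …, C_k` are invariants of `ζ' = f(ζ)`, the `DC_j(ζ₀)` are linearly
independent, and some combination `V = ℰ + Σ c_j·C_j` has a critical point at `ζ₀` whose
Hessian is (positive or negative) definite on `⋂ⱼ ker DC_j(ζ₀)`, then `ζ₀` is Lyapunov
stable. -/
theorem stmt_11 (n k : ℕ) (hn : 1 ≤ n) (hk : 1 ≤ k)
    (f : EuclideanSpace ℝ (Fin n) → EuclideanSpace ℝ (Fin n)) (hf : LocallyLipschitz f)
    (ζ₀ : EuclideanSpace ℝ (Fin n)) (hζ₀ : f ζ₀ = 0)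
    (E : EuclideanSpace ℝ (Fin n) → ℝ) (C : Fin k → EuclideanSpace ℝ (Fin n) → ℝ)
    (hE : ContDiff ℝ 2 E) (hC : ∀ j, ContDiff ℝ 2 (C j))
    (hEinv : ∀ J : Set ℝ, J.OrdConnected → ∀ ζ : ℝ → EuclideanSpace ℝ (Fin n),
      (∀ t ∈ J, HasDerivWithinAt ζ (f (ζ t)) J t) →
      ∀ t ∈ J, ∀ s ∈ J, E (ζ t) = E (ζ s))
    (hCinv : ∀ j : Fin k, ∀ J : Set ℝ, J.OrdConnected → ∀ ζ : ℝ → EuclideanSpace ℝ (Fin n),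
      (∀ t ∈ J, HasDerivWithinAt ζ (f (ζ t)) J t) →
      ∀ t ∈ J, ∀ s ∈ J, C j (ζ t) = C j (ζ s))
    (hind : LinearIndependent ℝ fun j : Fin k => fderiv ℝ (C j) ζ₀)
    (c : Fin k → ℝ)
    (hcrit : fderiv ℝ (fun x => E x + ∑ j, c j * C j x) ζ₀ = 0)
    (hdef :
      (∀ w : EuclideanSpace ℝ (Fin n), w ≠ 0 → (∀ j, fderiv ℝ (C j) ζ₀ w = 0) →
        0 < iteratedFDeriv ℝ 2 (fun x => E x + ∑ j, c j * C j x) ζ₀ ![w, w]) ∨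
      (∀ w : EuclideanSpace ℝ (Fin n), w ≠ 0 → (∀ j, fderiv ℝ (C j) ζ₀ w = 0) →
        iteratedFDeriv ℝ 2 (fun x => E x + ∑ j, c j * C j x) ζ₀ ![w, w] < 0)) :
    ∀ ε > (0 : ℝ), ∃ δ > (0 : ℝ), ∀ (T : ℝ) (ζ : ℝ → EuclideanSpace ℝ (Fin n)),
      (∀ t ∈ Set.Ico (0 : ℝ) T, HasDerivWithinAt ζ (f (ζ t)) (Set.Ico (0 : ℝ) T) t) →
      ‖ζ 0 - ζ₀‖ < δ → ∀ t ∈ Set.Ico (0 : ℝ) T, ‖ζ t - ζ₀‖ < ε := by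
  intro ε hε
  set V : EuclideanSpace ℝ (Fin n) → ℝ := fun x => E x + ∑ j, c j * C j x
  have hV : ContDiff ℝ 2 V :=
    hE.add (ContDiff.sum fun j _ => contDiff_const.mul (hC j))
  have hVd : Differentiable ℝ V := hV.differentiable two_ne_zero
  have hB : HasFDerivAt (fderiv ℝ V) (fderiv ℝ (fderiv ℝ V) ζ₀) ζ₀ :=
    ((hV.fderiv_right (m := 1) (by norm_num)).differentiable one_ne_zero ζ₀).hasFDerivAt
  have hP : HasFDerivAt (fun x j => C j x)
      (ContinuousLinearMap.pi fun j => fderiv ℝ (C j) ζ₀) ζ₀ :=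
    hasFDerivAt_pi.2 fun j => ((hC j).differentiable two_ne_zero ζ₀).hasFDerivAt
  have hne : ∀ w, w ≠ 0 → ContinuousLinearMap.pi (fun j => fderiv ℝ (C j) ζ₀) w = 0 →
      fderiv ℝ (fderiv ℝ V) ζ₀ w w ≠ 0 := by
    intro w hw hL
    have hker : ∀ j, fderiv ℝ (C j) ζ₀ w = 0 := fun j => congrFun hL j
    have hhess : iteratedFDeriv ℝ 2 V ζ₀ ![w, w] = fderiv ℝ (fderiv ℝ V) ζ₀ w w := by
      simp [iteratedFDeriv_two_apply]
    rw [← hhess]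
    rcases hdef with hpos | hneg
    · exact (hpos w hw hker).ne'
    · exact (hneg w hw hker).ne
  have hQ : Continuous fun x => (V x, fun j => C j x) :=
    hV.continuous.prodMk (continuous_pi fun j => (hC j).continuous)
  have hiso : ∀ᶠ x in 𝓝 ζ₀, (V x, fun j => C j x) = (V ζ₀, fun j => C j ζ₀) → x = ζ₀ := by
    filter_upwards [isolated_in_level_set_of_hessian_ne_zero hVd hcrit hB hP hne] with x hx h
    exact hx (congrArg Prod.fst h) (congrArg Prod.snd h)
  obtain ⟨δ, hδ, hstable⟩ := stable_of_isolated_in_level_set hQ hiso hε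
  refine ⟨δ, hδ, fun T ζ hζ h0 t ht => hstable T ζ (fun s hs => (hζ s hs).continuousWithinAt)
    (fun s hs => ?_) h0 t ht⟩
  have h0T : (0 : ℝ) ∈ Ico 0 T := ⟨le_rfl, hs.1.trans_lt hs.2⟩
  have hCs : ∀ j, C j (ζ s) = C j (ζ 0) := fun j => hCinv j _ ordConnected_Ico ζ hζ s hs 0 h0T
  have hEs : E (ζ s) = E (ζ 0) := hEinv _ ordConnected_Ico ζ hζ s hs 0 h0T
  simp [V, hCs, hEs]
end

section
/- (Proposition 6.1, matching identity.) Suppose σ⁻¹ + ρ⁻¹ = G⁻¹. Then for every ξ ∈ ℝⁿ, every θ̇ ∈ ℝˢ, and every i ∈ {1, …, n}: Σ_b ( A_{ib} + Σ_a σ_{ab}·T^a_i )·( Σ_j T^b_j·ξ^j ) + Σ_{a,b,c} G_{ab}·ρ^{bc}·π̃_c·T^a_i + Σ_{a,b,d} ( ρ_{ab} − G_{ab} )·ρ^{ad}·π̃_d·( Σ_c G^{bc}·A_{ic} + T^b_i ) = 0. Consequently, for any symmetric real n×n matrix 𝒢, the controlled momentum p̃_i := Σ_j 𝒢_{ij}·ξ^j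 + Σ_a A_{ia}·θ̇^a + [the left-hand side above] coincides with the momentum p_i := Σ_j 𝒢_{ij}·ξ^j + Σ_a A_{ia}·θ̇^a, i.e., the controlled Euler–Poincaré equations match the uncontrolled ones for the controlled Lagrangian. -/
open scoped Matrix


open Finset in
/-- Matching identity for the method of Controlled Lagrangians: if `σ⁻¹ + ρ⁻¹ = G⁻¹` and
`T = −σ⁻¹·Aᵀ`, then the correction terms in the controlled momentum vanish, so the
controlled momentum `p̃` coincides with the momentum `p`. -/
theorem stmt_12 (n s : ℕ) (hn : 0 < n) (hs : 0 < s)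
    (A : Matrix (Fin n) (Fin s) ℝ)
    (G σ ρ : Matrix (Fin s) (Fin s) ℝ)
    (hGsymm : G.IsSymm) (hσsymm : σ.IsSymm) (hρsymm : ρ.IsSymm)
    (hGu : IsUnit G.det) (hσu : IsUnit σ.det) (hρu : IsUnit ρ.det)
    (hmatch : σ⁻¹ + ρ⁻¹ = G⁻¹)
    (T : Matrix (Fin s) (Fin n) ℝ)
    (hT : ∀ a i, T a i = -∑ b, σ⁻¹ a b * A i b)
    (ξ : Fin n → ℝ) (θd : Fin s → ℝ)
    (πt : Fin s → ℝ)
    (hπ : ∀ a, πt a = ∑ b, ρ a b *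
      (θd b + (∑ c, ∑ i, G⁻¹ b c * A i c * ξ i) + ∑ i, T b i * ξ i))
    (i : Fin n) :
    ((∑ b, (A i b + ∑ a, σ a b * T a i) * ∑ j, T b j * ξ j)
      + (∑ a, ∑ b, ∑ c, G a b * ρ⁻¹ b c * πt c * T a i)
      + ∑ a, ∑ b, ∑ d, (ρ a b - G a b) * ρ⁻¹ a d * πt d *
          ((∑ c, G⁻¹ b c * A i c) + T b i)) = 0
    ∧ ∀ 𝒢 : Matrix (Fin n) (Fin n) ℝ, 𝒢.IsSymm →
      ((∑ j, 𝒢 i j * ξ j) + (∑ a, A i a * θd a)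
        + ((∑ b, (A i b + ∑ a, σ a b * T a i) * ∑ j, T b j * ξ j)
          + (∑ a, ∑ b, ∑ c, G a b * ρ⁻¹ b c * πt c * T a i)
          + ∑ a, ∑ b, ∑ d, (ρ a b - G a b) * ρ⁻¹ a d * πt d *
              ((∑ c, G⁻¹ b c * A i c) + T b i)))
        = (∑ j, 𝒢 i j * ξ j) + ∑ a, A i a * θd a := by
  have hTi : (fun a => T a i) = -(σ⁻¹ *ᵥ A i) := by
    ext a
    simp [hT, Matrix.mulVec, dotProduct]
  have hσT : ∀ b, A i b + ∑ a, σ a b * T a i = 0 := by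
    intro b
    have h : (σ *ᵥ fun a => T a i) b = -A i b := by
      rw [hTi, Matrix.mulVec_neg, Matrix.mulVec_mulVec, Matrix.mul_nonsing_inv _ hσu,
        Matrix.one_mulVec, Pi.neg_apply]
    have h' : ∑ a, σ a b * T a i = (σ *ᵥ fun a => T a i) b :=
      Finset.sum_congr rfl fun a _ => by rw [hσsymm.apply b a]
    rw [h', h, add_neg_cancel]
  have hGT : (G⁻¹ *ᵥ A i + fun a => T a i) = ρ⁻¹ *ᵥ A i := by
    rw [hTi, ← hmatch, Matrix.add_mulVec]
    abel
  set w := ρ⁻¹ *ᵥ πt with hw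
  have hsecond : ∑ a, ∑ b, ∑ c, G a b * ρ⁻¹ b c * πt c * T a i =
      w ⬝ᵥ (G *ᵥ fun a => T a i) := by
    simp only [dotProduct, Matrix.mulVec, hw, Finset.sum_mul, Finset.mul_sum]
    rw [Finset.sum_comm]
    refine Finset.sum_congr rfl fun b _ => Finset.sum_congr rfl fun a _ =>
      Finset.sum_congr rfl fun c _ => ?_
    rw [hGsymm.apply b a]
    ring
  have hthird : ∑ a, ∑ b, ∑ d, (ρ a b - G a b) * ρ⁻¹ a d * πt d *
      ((∑ c, G⁻¹ b c * A i c) + T b i) =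
      w ⬝ᵥ ((ρ - G) *ᵥ (G⁻¹ *ᵥ A i + fun a => T a i)) := by
    change _ = ∑ a, (∑ d, ρ⁻¹ a d * πt d) *
      ∑ b, (ρ a b - G a b) * ((∑ c, G⁻¹ b c * A i c) + T b i)
    refine Finset.sum_congr rfl fun a _ => ?_
    rw [Finset.mul_sum]
    refine Finset.sum_congr rfl fun b _ => ?_
    rw [Finset.sum_mul]
    exact Finset.sum_congr rfl fun d _ => by ring
  have hvec : (G *ᵥ fun a => T a i) + (ρ - G) *ᵥ (ρ⁻¹ *ᵥ A i) = 0 := by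
    have hG : G *ᵥ (σ⁻¹ *ᵥ A i) + G *ᵥ (ρ⁻¹ *ᵥ A i) = A i := by
      rw [← Matrix.mulVec_add, ← Matrix.add_mulVec, hmatch, Matrix.mulVec_mulVec,
        Matrix.mul_nonsing_inv _ hGu, Matrix.one_mulVec]
    have hρ : ρ *ᵥ (ρ⁻¹ *ᵥ A i) = A i := by
      rw [Matrix.mulVec_mulVec, Matrix.mul_nonsing_inv _ hρu, Matrix.one_mulVec]
    rw [hTi, Matrix.mulVec_neg, Matrix.sub_mulVec, hρ]
    nth_rewrite 2 [← hG]
    abel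
  have hzero : ((∑ b, (A i b + ∑ a, σ a b * T a i) * ∑ j, T b j * ξ j)
      + (∑ a, ∑ b, ∑ c, G a b * ρ⁻¹ b c * πt c * T a i)
      + ∑ a, ∑ b, ∑ d, (ρ a b - G a b) * ρ⁻¹ a d * πt d *
          ((∑ c, G⁻¹ b c * A i c) + T b i)) = 0 := by
    rw [hsecond, hthird, hGT, add_assoc, ← dotProduct_add, hvec]
    simp [hσT]
  exact ⟨hzero, fun _ _ => by rw [hzero, add_zero]⟩
end

section
/- Let Y₀ ∈ ℝ and ζ_sl := (0, 0, Y₀, 0, 1). Define on a neighborhood of ζ_sl in ℝ⁵ the functions ℰ̃(ζ) := (1/2)·(a·v₁² + ((𝓘₂ + m·l²)·Γ₂² + 𝓘₃·Γ₃²)·v₂² + 2·m·l·Γ₂·v₂·v₃ + m·v₃²) + m·g·l·Γ₃, C̃₁(ζ) := (𝓘₂·Γ₂² + 𝓘₃·Γ₃²)·v₂, C̃₂(ζ) := l·Γ₂·v₂ + v₃ + ( l·C̃₁(ζ)/√(𝓘₃·(𝓘₂ − 𝓘₃)) )·arctan( √((𝓘₂ − 𝓘₃)/𝓘₃)·Γ₂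 ), and C̃₃(ζ) := (Γ₂² + Γ₃²)/2. Then the function V := ℰ̃ − m·Y₀·C̃₂ − m·g·l·C̃₃ satisfies DV(ζ_sl) = 0; and if moreover −J₁²/(I₁ + m·l²) < σ < 0 (so that a < 0), then D²V(ζ_sl)(w, w) < 0 for every nonzero w ∈ ℝ⁵ with DC̃₁(ζ_sl)(w) = DC̃₂(ζ_sl)(w) = DC̃₃(ζ_sl)(w) = 0. -/
/-- The controlled constrained energy `ℰ̃` of the pendulum skate with internal rotor,
where `a = I₁ + m·l² + J₁²/σ`, `𝓘₂ = I₂ + J₂`, `𝓘₃ = I₃ + J₃`. -/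
noncomputable def cskateE (m g l a 𝓘₂ 𝓘₃ : ℝ) (ζ : Fin 5 → ℝ) : ℝ :=
  (1 / 2) * (a * ζ 0 ^ 2
      + ((𝓘₂ + m * l ^ 2) * ζ 3 ^ 2 + 𝓘₃ * ζ 4 ^ 2) * ζ 1 ^ 2
      + 2 * m * l * ζ 3 * ζ 1 * ζ 2 + m * ζ 2 ^ 2) + m * g * l * ζ 4

/-- The invariant `C̃₁ = (𝓘₂·Γ₂² + 𝓘₃·Γ₃²)·v₂`. -/
noncomputable def cskateC₁ (𝓘₂ 𝓘₃ : ℝ) (ζ : Fin 5 → ℝ) : ℝ :=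
  (𝓘₂ * ζ 3 ^ 2 + 𝓘₃ * ζ 4 ^ 2) * ζ 1

/-- The invariant `C̃₂ = l·Γ₂·v₂ + v₃ + (l·C̃₁/√(𝓘₃·(𝓘₂−𝓘₃)))·arctan(√((𝓘₂−𝓘₃)/𝓘₃)·Γ₂)`. -/
noncomputable def cskateC₂ (l 𝓘₂ 𝓘₃ : ℝ) (ζ : Fin 5 → ℝ) : ℝ :=
  l * ζ 3 * ζ 1 + ζ 2
    + l * cskateC₁ 𝓘₂ 𝓘₃ ζ / Real.sqrt (𝓘₃ * (𝓘₂ - 𝓘₃))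
      * Real.arctan (Real.sqrt ((𝓘₂ - 𝓘₃) / 𝓘₃) * ζ 3)

/-- The invariant `C̃₃ = (Γ₂² + Γ₃²)/2`. -/
noncomputable def cskateC₃ (ζ : Fin 5 → ℝ) : ℝ := (ζ 3 ^ 2 + ζ 4 ^ 2) / 2

theorem contDiff_cskateE (m g l a 𝓘₂ 𝓘₃ : ℝ) {n : WithTop ℕ∞} :
    ContDiff ℝ n (cskateE m g l a 𝓘₂ 𝓘₃) := by
  unfold cskateE
  fun_prop

theorem contDiff_cskateC₁ (𝓘₂ 𝓘₃ : ℝ) {n : WithTop ℕ∞} :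
    ContDiff ℝ n (cskateC₁ 𝓘₂ 𝓘₃) := by
  unfold cskateC₁
  fun_prop

theorem contDiff_cskateC₂ (l 𝓘₂ 𝓘₃ : ℝ) {n : WithTop ℕ∞} :
    ContDiff ℝ n (cskateC₂ l 𝓘₂ 𝓘₃) := by
  have h := contDiff_cskateC₁ 𝓘₂ 𝓘₃ (n := n)
  unfold cskateC₂
  exact (by fun_prop : ContDiff ℝ n fun ζ : Fin 5 → ℝ => l * ζ 3 * ζ 1 + ζ 2).add
    (((contDiff_const.mul h).div_const _).mul
      (Real.contDiff_arctan.comp (by fun_prop)))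

theorem contDiff_cskateC₃ {n : WithTop ℕ∞} : ContDiff ℝ n cskateC₃ := by
  unfold cskateC₃
  fun_prop

theorem fderiv_cskateE_sliding (m g l a 𝓘₂ 𝓘₃ Y₀ : ℝ) (w : Fin 5 → ℝ) :
    fderiv ℝ (cskateE m g l a 𝓘₂ 𝓘₃) ![0, 0, Y₀, 0, 1] w =
      m * Y₀ * w 2 + m * g * l * w 4 := by
  have h (i : Fin 5) := hasFDerivAt_apply (𝕜 := ℝ) i (![0, 0, Y₀, 0, 1] : Fin 5 → ℝ)
  have H := ((((((h 0).pow 2).const_mul a).add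
    (((((h 3).pow 2).const_mul (𝓘₂ + m * l ^ 2)).add
      (((h 4).pow 2).const_mul 𝓘₃)).mul ((h 1).pow 2))).add
    ((((h 3).const_mul (2 * m * l)).mul (h 1)).mul (h 2))).add
    (((h 2).pow 2).const_mul m)).const_mul (1 / 2) |>.add ((h 4).const_mul (m * g * l))
  have H' : HasFDerivAt (cskateE m g l a 𝓘₂ 𝓘₃) _ _ := H
  rw [H'.fderiv]
  simp
  ring

theorem fderiv_cskateC₁_sliding (𝓘₂ 𝓘₃ Y₀ : ℝ) (w : Fin 5 → ℝ) :
    fderiv ℝ (cskateC₁ 𝓘₂ 𝓘₃) ![0, 0, Y₀, 0, 1] w = 𝓘₃ * w 1 := by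
  have h (i : Fin 5) := hasFDerivAt_apply (𝕜 := ℝ) i (![0, 0, Y₀, 0, 1] : Fin 5 → ℝ)
  have H : HasFDerivAt (cskateC₁ 𝓘₂ 𝓘₃) _ _ :=
    ((((h 3).pow 2).const_mul 𝓘₂).add (((h 4).pow 2).const_mul 𝓘₃)).mul (h 1)
  rw [H.fderiv]
  simp

theorem fderiv_cskateC₂_sliding (l 𝓘₂ 𝓘₃ Y₀ : ℝ) (w : Fin 5 → ℝ) :
    fderiv ℝ (cskateC₂ l 𝓘₂ 𝓘₃) ![0, 0, Y₀, 0, 1] w = w 2 := by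
  have h (i : Fin 5) := hasFDerivAt_apply (𝕜 := ℝ) i (![0, 0, Y₀, 0, 1] : Fin 5 → ℝ)
  have hC := ((contDiff_cskateC₁ 𝓘₂ 𝓘₃ (n := 1)).differentiable one_ne_zero
    ![0, 0, Y₀, 0, 1]).hasFDerivAt
  have H : HasFDerivAt (cskateC₂ l 𝓘₂ 𝓘₃) _ _ :=
    ((((h 3).const_mul l).mul (h 1)).add (h 2)).add
      (((hC.const_mul l).mul_const (Real.sqrt (𝓘₃ * (𝓘₂ - 𝓘₃)))⁻¹).mul
        ((h 3).const_mul (Real.sqrt ((𝓘₂ - 𝓘₃) / 𝓘₃))).arctan)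
  rw [H.fderiv]
  simp [cskateC₁]

theorem fderiv_cskateC₃_sliding (Y₀ : ℝ) (w : Fin 5 → ℝ) :
    fderiv ℝ cskateC₃ ![0, 0, Y₀, 0, 1] w = w 4 := by
  have h (i : Fin 5) := hasFDerivAt_apply (𝕜 := ℝ) i (![0, 0, Y₀, 0, 1] : Fin 5 → ℝ)
  have H : HasFDerivAt cskateC₃ _ _ :=
    (((h 3).pow 2).add ((h 4).pow 2)).mul_const (2 : ℝ)⁻¹
  rw [H.fderiv]
  simp

/-- A `C²` function that is quadratic along a line has the corresponding second derivative. -/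
theorem ContDiff.iteratedFDeriv_two_eq_of_quadratic_on_line {E : Type*} [NormedAddCommGroup E]
    [NormedSpace ℝ E] {f : E → ℝ} (hf : ContDiff ℝ 2 f) {x w : E} {c q : ℝ}
    (h : ∀ t : ℝ, f (x + t • w) = c + q / 2 * t ^ 2) :
    iteratedFDeriv ℝ 2 f x ![w, w] = q := by
  have hline (t : ℝ) : HasDerivAt (fun s : ℝ => x + s • w) w t := by
    simpa using ((hasDerivAt_id t).smul_const w).const_add x
  have h₁ (t : ℝ) : fderiv ℝ f (x + t • w) w = q * t := by
    have hd :=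
      (hf.differentiable two_ne_zero (x + t • w)).hasFDerivAt.comp_hasDerivAt t (hline t)
    have hq : HasDerivAt (fun s : ℝ => c + q / 2 * s ^ 2) (q * t) t := by
      refine (((hasDerivAt_pow 2 t).const_mul (q / 2)).const_add c).congr_deriv ?_
      norm_num
      ring
    exact (hd.congr_of_eventuallyEq (.of_forall fun s => (h s).symm)).unique hq
  have hf' : Differentiable ℝ (fderiv ℝ f) :=
    (hf.fderiv_right (m := 1) (by norm_num)).differentiable one_ne_zero
  have h₂ : HasDerivAt (fun t : ℝ => fderiv ℝ f (x + t • w))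
      (fderiv ℝ (fderiv ℝ f) (x + (0 : ℝ) • w) w) 0 :=
    (hf' (x + (0 : ℝ) • w)).hasFDerivAt.comp_hasDerivAt 0 (hline 0)
  have h₃ : HasDerivAt (fun t : ℝ => fderiv ℝ f (x + t • w) w)
      (fderiv ℝ (fderiv ℝ f) (x + (0 : ℝ) • w) w w) 0 :=
    (ContinuousLinearMap.apply ℝ ℝ w).hasFDerivAt.comp_hasDerivAt 0 h₂
  have hq : HasDerivAt (fun t : ℝ => fderiv ℝ f (x + t • w) w) q 0 := by
    simpa only [h₁, mul_one] using (hasDerivAt_id' (0 : ℝ)).const_mul q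
  simpa [iteratedFDeriv_two_apply] using h₃.unique hq

/-- At the sliding equilibrium `ζ_sl = (0, 0, Y₀, 0, 1)`, the function
`V = ℰ̃ − m·Y₀·C̃₂ − m·g·l·C̃₃` has vanishing derivative, and if
`−J₁²/(I₁ + m·l²) < σ < 0` (so that `a < 0`), its second-derivative quadratic form is
negative definite on the joint kernel of `DC̃₁`, `DC̃₂`, `DC̃₃` at `ζ_sl`. -/
theorem stmt_14 (m g l I₁ I₂ I₃ J₁ J₂ J₃ σ : ℝ)
    (hm : 0 < m) (hg : 0 < g) (hl : 0 < l)
    (hI₁ : 0 < I₁) (hI₂ : 0 < I₂) (hI₃ : 0 < I₃)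
    (hJ₁ : 0 < J₁) (hJ₂ : 0 ≤ J₂) (hJ₃ : 0 ≤ J₃)
    (hIJ : I₃ + J₃ < I₂ + J₂) (hσ : σ ≠ 0)
    (ha : I₁ + m * l ^ 2 + J₁ ^ 2 / σ ≠ 0) (Y₀ : ℝ) :
    fderiv ℝ (fun ζ => cskateE m g l (I₁ + m * l ^ 2 + J₁ ^ 2 / σ) (I₂ + J₂) (I₃ + J₃) ζ
        - m * Y₀ * cskateC₂ l (I₂ + J₂) (I₃ + J₃) ζ
        - m * g * l * cskateC₃ ζ) ![0, 0, Y₀, 0, 1] = 0 ∧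
    (-(J₁ ^ 2) / (I₁ + m * l ^ 2) < σ → σ < 0 →
      ∀ w : Fin 5 → ℝ, w ≠ 0 →
        fderiv ℝ (cskateC₁ (I₂ + J₂) (I₃ + J₃)) ![0, 0, Y₀, 0, 1] w = 0 →
        fderiv ℝ (cskateC₂ l (I₂ + J₂) (I₃ + J₃)) ![0, 0, Y₀, 0, 1] w = 0 →
        fderiv ℝ cskateC₃ ![0, 0, Y₀, 0, 1] w = 0 →
        iteratedFDeriv ℝ 2
            (fun ζ => cskateE m g l (I₁ + m * l ^ 2 + J₁ ^ 2 / σ) (I₂ + J₂) (I₃ + J₃) ζ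
              - m * Y₀ * cskateC₂ l (I₂ + J₂) (I₃ + J₃) ζ
              - m * g * l * cskateC₃ ζ) ![0, 0, Y₀, 0, 1] ![w, w] < 0) := by
  have hE := contDiff_cskateE m g l (I₁ + m * l ^ 2 + J₁ ^ 2 / σ) (I₂ + J₂) (I₃ + J₃) (n := 2)
  have hC₂ := contDiff_cskateC₂ l (I₂ + J₂) (I₃ + J₃) (n := 2)
  have hC₃ := contDiff_cskateC₃ (n := 2)
  refine ⟨?_, fun hσ₁ hσ₂ w hw hw₁ hw₂ hw₃ => ?_⟩
  · ext1 w
    have H := (((hE.differentiable two_ne_zero ![0, 0, Y₀, 0, 1]).hasFDerivAt.sub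
      ((hC₂.differentiable two_ne_zero ![0, 0, Y₀, 0, 1]).hasFDerivAt.const_mul (m * Y₀))).sub
      ((hC₃.differentiable two_ne_zero ![0, 0, Y₀, 0, 1]).hasFDerivAt.const_mul (m * g * l)))
    refine (congrArg (fun L => L w) H.fderiv).trans ?_
    simp [fderiv_cskateE_sliding, fderiv_cskateC₂_sliding, fderiv_cskateC₃_sliding]
  · rw [fderiv_cskateC₁_sliding] at hw₁
    rw [fderiv_cskateC₂_sliding] at hw₂
    rw [fderiv_cskateC₃_sliding] at hw₃
    replace hw₁ : w 1 = 0 := (mul_eq_zero.mp hw₁).resolve_left (by positivity)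
    have ha_neg : I₁ + m * l ^ 2 + J₁ ^ 2 / σ < 0 := by
      have hI : 0 < I₁ + m * l ^ 2 := by positivity
      rw [div_lt_iff₀ hI] at hσ₁
      have : J₁ ^ 2 / σ < -(I₁ + m * l ^ 2) := by
        rw [div_lt_iff_of_neg hσ₂]
        linarith
      linarith
    have hmgl : 0 < m * g * l := by positivity
    rw [((hE.sub (contDiff_const.mul hC₂)).sub
      (contDiff_const.mul hC₃)).iteratedFDeriv_two_eq_of_quadratic_on_line
      (c := m * g * l / 2 - m * Y₀ ^ 2 / 2)
      (q := (I₁ + m * l ^ 2 + J₁ ^ 2 / σ) * w 0 ^ 2 - m * g * l * w 3 ^ 2)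
      fun t => by
        simp [cskateE, cskateC₁, cskateC₂, cskateC₃, hw₁, hw₂, hw₃]
        ring]
    by_cases h₀ : w 0 = 0
    · have h₃ : w 3 ≠ 0 := fun h₃ => hw <| by
        ext i
        fin_cases i <;> assumption
      have := mul_pos hmgl (pow_pos (abs_pos.mpr h₃) 2)
      rw [sq_abs] at this
      simpa [h₀] using this
    · have := mul_neg_of_neg_of_pos ha_neg (pow_pos (abs_pos.mpr h₀) 2)
      rw [sq_abs] at this
      have := mul_nonneg hmgl.le (sq_nonneg (w 3))
      linarith
end

section
/- (Theorem 4.1.) Let t ↦ (v(t), Γ(t)) ∈ ℝ^{n−r} × X* be a differentiable curve with I-coordinates Γ_i(t) := ⟨Γ(t), e_i⟩, and set ξ(t) := Σ_α v^α(t)·𝓔_α(Γ(t)) ∈ 𝔡(Γ(t)). Define p_i(t) := ⟨ (∂ℓ/∂ξ)(ξ(t), Γ(t)), 𝓔_i(Γ(t)) ⟩ for i = 1, …, n. Then the following are equivalent: (i) there exist functions λ_a : ℝ → ℝ (a = 1, …, r) such that for all t, d/dt[ (∂ℓ/∂ξ)(ξ(t), Γ(t)) ] = ad*_{ξ(t)}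 (∂ℓ/∂ξ)(ξ(t), Γ(t)) + K( (∂ℓ/∂Γ)(ξ(t), Γ(t)), Γ(t) ) + Σ_a λ_a(t)·ψ^a(Γ(t)) and Γ'(t) = −ξ(t)·Γ(t); (ii) for all t and all α = 1, …, n−r and i = 1, …, n (sums over repeated indices), ṗ_α = −ℬ^i_{αβ}(Γ)·p_i·v^β + 𝒦^k_{αj}(Γ)·(∂ℓ/∂Γ)^j·Γ_k and Γ̇_i = −ϰ^k_{iβ}(Γ)·v^β·Γ_k. -/
noncomputable section

/-- Embedding of the constraint-distribution indices `{1,…,n−r}` into `{1,…,n}`. -/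
def dEmb (n r : ℕ) : Fin (n - r) → Fin n := Fin.castLE (Nat.sub_le n r)

/-- The curve `ξ(t) = Σ_α v^α(t)·𝓔_α(Γ(t))`, in coordinates w.r.t. the fixed basis
`{E_i}` of `𝔰`; here `ℰ Γ` is the matrix with entries `𝓔^i_j(Γ)`. -/
def xiCurve (n r dX : ℕ) (ℰ : (Fin dX → ℝ) → Matrix (Fin n) (Fin n) ℝ)
    (v : ℝ → Fin (n - r) → ℝ) (Γ : ℝ → Fin dX → ℝ) (t : ℝ) : Fin n → ℝ :=
  fun i => ∑ α, v t α * ℰ (Γ t) i (dEmb n r α)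

/-- `p_i(t) = ⟨(∂ℓ/∂ξ)(ξ(t), Γ(t)), 𝓔_i(Γ(t))⟩`, where `Dξℓ` gives the coordinates of
`∂ℓ/∂ξ` in the dual basis of `{E_i}`. -/
def pCurve (n r dX : ℕ) (ℰ : (Fin dX → ℝ) → Matrix (Fin n) (Fin n) ℝ)
    (Dξℓ : (Fin n → ℝ) → (Fin dX → ℝ) → Fin n → ℝ)
    (v : ℝ → Fin (n - r) → ℝ) (Γ : ℝ → Fin dX → ℝ) (t : ℝ) (i : Fin n) : ℝ :=
  ∑ j, Dξℓ (xiCurve n r dX ℰ v Γ t) (Γ t) j * ℰ (Γ t) j i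

/-- `ϰ^k_{iβ}(Γ) = κ^k_{ij}·𝓔^j_β(Γ)`, where `κ k i j` denotes `κ^k_{ij}`. -/
def varkappa (n r dX : ℕ) (κ : Fin dX → Fin dX → Fin n → ℝ)
    (ℰ : (Fin dX → ℝ) → Matrix (Fin n) (Fin n) ℝ) (Γ : Fin dX → ℝ)
    (k i : Fin dX) (β : Fin (n - r)) : ℝ :=
  ∑ j, κ k i j * ℰ Γ j (dEmb n r β)

/-- `ℬ^i_{αβ}(Γ) = 𝒞^i_{αβ}(Γ) + ℱ^i_{αβ}(Γ)`, where
`𝒞^i_{αβ} = 𝓔^l_α·𝓔^m_β·c^p_{lm}·(𝓔⁻¹)^i_p` are the `Γ`-dependent structure constants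
(`c l m p` denoting `c^p_{lm}`) and
`ℱ^i_{αβ} = (∂𝓔^l_α/∂Γ_j)·(𝓔⁻¹)^i_l·ϰ^k_{jβ}·Γ_k`. -/
def calB (n r dX : ℕ) (c : Fin n → Fin n → Fin n → ℝ)
    (κ : Fin dX → Fin dX → Fin n → ℝ)
    (ℰ : (Fin dX → ℝ) → Matrix (Fin n) (Fin n) ℝ) (Γ : Fin dX → ℝ)
    (i : Fin n) (α β : Fin (n - r)) : ℝ :=
  (∑ l, ∑ m, ∑ p, ℰ Γ l (dEmb n r α) * ℰ Γ m (dEmb n r β) * c l m p * (ℰ Γ)⁻¹ i p)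
    + ∑ l, ∑ j, ∑ k, fderiv ℝ (fun Γ' => ℰ Γ' l (dEmb n r α)) Γ (Pi.single j 1)
        * (ℰ Γ)⁻¹ i l * varkappa n r dX κ ℰ Γ k j β * Γ k

/-- `𝒦^k_{ij}(Γ) = ⟨K(e_j, e*^k), 𝓔_i(Γ)⟩`, written `calK … Γ i j k`. -/
def calK (n dX : ℕ) (κ : Fin dX → Fin dX → Fin n → ℝ)
    (ℰ : (Fin dX → ℝ) → Matrix (Fin n) (Fin n) ℝ) (Γ : Fin dX → ℝ)
    (i : Fin n) (j k : Fin dX) : ℝ :=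
  -∑ p, κ k j p * ℰ Γ p i

theorem dEmb_injective (n r : ℕ) : Function.Injective (dEmb n r) :=
  Fin.castLE_injective _

/-- Linearly independent covectors annihilating the first `n - r` columns of an invertible
matrix span the annihilator as soon as there are `r` of them. -/
theorem exists_sum_smul_of_annihilates {n r : ℕ} (hrn : r ≤ n) {M : Matrix (Fin n) (Fin n) ℝ}
    (hM : IsUnit M.det) {ψ : Fin r → Fin n → ℝ} (hψ : LinearIndependent ℝ ψ)
    (hann : ∀ a α, ∑ i, ψ a i * M i (dEmb n r α) = 0)
    {w : Fin n → ℝ} (hw : ∀ α, ∑ i, w i * M i (dEmb n r α) = 0) :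
    ∃ lam : Fin r → ℝ, ∀ i, w i = ∑ a, lam a * ψ a i := by
  let L : (Fin n → ℝ) →ₗ[ℝ] (Fin (n - r) → ℝ) :=
    (LinearMap.funLeft ℝ ℝ (dEmb n r)) ∘ₗ M.vecMulLinear
  have hL : ∀ x α, L x α = ∑ i, x i * M i (dEmb n r α) := fun x α => rfl
  have hsurj : Function.Surjective L := by
    intro y
    obtain ⟨z, rfl⟩ := LinearMap.funLeft_surjective_of_injective ℝ ℝ _ (dEmb_injective n r) y
    exact ⟨Matrix.vecMul z M⁻¹, by
      simp [L, Matrix.vecMul_vecMul, Matrix.nonsing_inv_mul M hM]⟩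
  have hker : Module.finrank ℝ (LinearMap.ker L) = r := by
    have h := L.finrank_range_add_finrank_ker
    rw [LinearMap.range_eq_top.2 hsurj, finrank_top] at h
    simp only [Module.finrank_fin_fun] at h
    omega
  have hle : Submodule.span ℝ (Set.range ψ) ≤ LinearMap.ker L := by
    rw [Submodule.span_le]
    rintro _ ⟨a, rfl⟩
    exact LinearMap.mem_ker.2 (funext fun α => (hL _ α).trans (hann a α))
  have heq : Submodule.span ℝ (Set.range ψ) = LinearMap.ker L :=
    Submodule.eq_of_le_of_finrank_eq hle (by
      rw [finrank_span_eq_card hψ, hker, Fintype.card_fin])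
  have hmem : w ∈ Submodule.span ℝ (Set.range ψ) :=
    heq ▸ LinearMap.mem_ker.2 (funext fun α => (hL _ α).trans (hw α))
  obtain ⟨lam, hlam⟩ := (Submodule.mem_span_range_iff_exists_fun ℝ).1 hmem
  exact ⟨lam, fun i => by simp [← hlam, Finset.sum_apply]⟩

theorem sum_varkappa_mul {n r dX : ℕ} (κ : Fin dX → Fin dX → Fin n → ℝ)
    (ℰ : (Fin dX → ℝ) → Matrix (Fin n) (Fin n) ℝ)
    (v : ℝ → Fin (n - r) → ℝ) (Γ : ℝ → Fin dX → ℝ) (t : ℝ) (k i : Fin dX) :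
    ∑ β, varkappa n r dX κ ℰ (Γ t) k i β * v t β
      = ∑ j, κ k i j * xiCurve n r dX ℰ v Γ t j := by
  simp only [varkappa, xiCurve, Finset.sum_mul, Finset.mul_sum]
  rw [Finset.sum_comm]
  exact Finset.sum_congr rfl fun _ _ => Finset.sum_congr rfl fun _ _ => by ring

theorem sum_varkappa_mul_mul {n r dX : ℕ} (κ : Fin dX → Fin dX → Fin n → ℝ)
    (ℰ : (Fin dX → ℝ) → Matrix (Fin n) (Fin n) ℝ)
    (v : ℝ → Fin (n - r) → ℝ) (Γ : ℝ → Fin dX → ℝ) (t : ℝ) (i : Fin dX) :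
    ∑ β, ∑ k, varkappa n r dX κ ℰ (Γ t) k i β * v t β * Γ t k
      = ∑ j, ∑ k, κ k i j * xiCurve n r dX ℰ v Γ t j * Γ t k := by
  rw [Finset.sum_comm, Finset.sum_comm (γ := Fin n)]
  simp only [← Finset.sum_mul, sum_varkappa_mul]

theorem sum_inv_mul_pCurve {n r dX : ℕ} {ℰ : (Fin dX → ℝ) → Matrix (Fin n) (Fin n) ℝ}
    (hℰ : ∀ Γ, IsUnit (ℰ Γ).det) (Dξℓ : (Fin n → ℝ) → (Fin dX → ℝ) → Fin n → ℝ)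
    (v : ℝ → Fin (n - r) → ℝ) (Γ : ℝ → Fin dX → ℝ) (t : ℝ) (l : Fin n) :
    ∑ i, (ℰ (Γ t))⁻¹ i l * pCurve n r dX ℰ Dξℓ v Γ t i
      = Dξℓ (xiCurve n r dX ℰ v Γ t) (Γ t) l := by
  have h : Matrix.vecMul (Matrix.vecMul (Dξℓ (xiCurve n r dX ℰ v Γ t) (Γ t)) (ℰ (Γ t)))
      (ℰ (Γ t))⁻¹ = Dξℓ (xiCurve n r dX ℰ v Γ t) (Γ t) := by
    rw [Matrix.vecMul_vecMul, Matrix.mul_nonsing_inv _ (hℰ _), Matrix.vecMul_one]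
  refine Eq.trans ?_ (congrFun h l)
  simp only [Matrix.vecMul, dotProduct, pCurve, mul_comm]

theorem sum_calB_mul_pCurve {n r dX : ℕ} (c : Fin n → Fin n → Fin n → ℝ)
    (κ : Fin dX → Fin dX → Fin n → ℝ) {ℰ : (Fin dX → ℝ) → Matrix (Fin n) (Fin n) ℝ}
    (hℰ : ∀ Γ, IsUnit (ℰ Γ).det) (Dξℓ : (Fin n → ℝ) → (Fin dX → ℝ) → Fin n → ℝ)
    (v : ℝ → Fin (n - r) → ℝ) (Γ : ℝ → Fin dX → ℝ) (t : ℝ) (α β : Fin (n - r)) :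
    ∑ i, calB n r dX c κ ℰ (Γ t) i α β * pCurve n r dX ℰ Dξℓ v Γ t i
      = (∑ l, ∑ m, ∑ p, ℰ (Γ t) l (dEmb n r α) * ℰ (Γ t) m (dEmb n r β) * c l m p
            * Dξℓ (xiCurve n r dX ℰ v Γ t) (Γ t) p)
        + ∑ l, ∑ j, ∑ k, fderiv ℝ (fun Γ' => ℰ Γ' l (dEmb n r α)) (Γ t) (Pi.single j 1)
            * Dξℓ (xiCurve n r dX ℰ v Γ t) (Γ t) l
            * varkappa n r dX κ ℰ (Γ t) k j β * Γ t k := by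
  simp only [← sum_inv_mul_pCurve hℰ Dξℓ v Γ t, calB, add_mul, Finset.sum_add_distrib]
  congr 1
  · simp only [Finset.sum_mul, Finset.mul_sum]
    rw [Finset.sum_comm]
    refine Finset.sum_congr rfl fun l _ => ?_
    rw [Finset.sum_comm]
    refine Finset.sum_congr rfl fun m _ => ?_
    rw [Finset.sum_comm]
    exact Finset.sum_congr rfl fun p _ => Finset.sum_congr rfl fun i _ => by ring
  · simp only [Finset.sum_mul, Finset.mul_sum]
    rw [Finset.sum_comm]
    refine Finset.sum_congr rfl fun l _ => ?_
    rw [Finset.sum_comm]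
    refine Finset.sum_congr rfl fun m _ => ?_
    rw [Finset.sum_comm]
    exact Finset.sum_congr rfl fun p _ => Finset.sum_congr rfl fun i _ => by ring

theorem sum_sum_calB_mul_pCurve {n r dX : ℕ} (c : Fin n → Fin n → Fin n → ℝ)
    (κ : Fin dX → Fin dX → Fin n → ℝ) {ℰ : (Fin dX → ℝ) → Matrix (Fin n) (Fin n) ℝ}
    (hℰ : ∀ Γ, IsUnit (ℰ Γ).det) (Dξℓ : (Fin n → ℝ) → (Fin dX → ℝ) → Fin n → ℝ)
    (v : ℝ → Fin (n - r) → ℝ) (Γ : ℝ → Fin dX → ℝ) (t : ℝ) (α : Fin (n - r)) :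
    ∑ β, ∑ i, calB n r dX c κ ℰ (Γ t) i α β * pCurve n r dX ℰ Dξℓ v Γ t i * v t β
      = (∑ l, ∑ m, ∑ p, ℰ (Γ t) l (dEmb n r α) * xiCurve n r dX ℰ v Γ t m * c l m p
            * Dξℓ (xiCurve n r dX ℰ v Γ t) (Γ t) p)
        + ∑ l, Dξℓ (xiCurve n r dX ℰ v Γ t) (Γ t) l
            * ∑ i, fderiv ℝ (fun Γ' => ℰ Γ' l (dEmb n r α)) (Γ t) (Pi.single i 1)
              * ∑ j, ∑ k, κ k i j * xiCurve n r dX ℰ v Γ t j * Γ t k := by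
  simp only [← Finset.sum_mul, sum_calB_mul_pCurve c κ hℰ, ← sum_varkappa_mul_mul, add_mul,
    Finset.sum_add_distrib]
  congr 1
  · simp only [xiCurve, Finset.sum_mul, Finset.mul_sum]
    rw [Finset.sum_comm]
    refine Finset.sum_congr rfl fun l _ => ?_
    rw [Finset.sum_comm]
    refine Finset.sum_congr rfl fun m _ => ?_
    rw [Finset.sum_comm]
    exact Finset.sum_congr rfl fun p _ => Finset.sum_congr rfl fun i _ => by ring
  · simp only [Finset.sum_mul, Finset.mul_sum]
    rw [Finset.sum_comm]
    refine Finset.sum_congr rfl fun l _ => ?_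
    rw [Finset.sum_comm]
    exact Finset.sum_congr rfl fun i _ => Finset.sum_congr rfl fun β _ =>
      Finset.sum_congr rfl fun k _ => by ring

theorem hasDerivAt_comp_sum {dX : ℕ} {f : (Fin dX → ℝ) → ℝ} (hf : Differentiable ℝ f)
    {Γ : ℝ → Fin dX → ℝ} {Γ' : Fin dX → ℝ} {t : ℝ}
    (hΓ : ∀ i, HasDerivAt (fun u => Γ u i) (Γ' i) t) :
    HasDerivAt (fun u => f (Γ u)) (∑ i, fderiv ℝ f (Γ t) (Pi.single i 1) * Γ' i) t := by
  have h : fderiv ℝ f (Γ t) Γ' = ∑ i, fderiv ℝ f (Γ t) (Pi.single i 1) * Γ' i := by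
    conv_lhs => rw [pi_eq_sum_univ' Γ', map_sum]
    exact Finset.sum_congr rfl fun i _ => by
      rw [map_smul, smul_eq_mul, mul_comm]
  rw [← h]
  exact (hf (Γ t)).hasFDerivAt.comp_hasDerivAt t (hasDerivAt_pi.2 hΓ)

/-- The right-hand side of the Euler–Poincaré equation without multipliers, contracted with
`𝓔_α`, plus the contribution of the derivative of `𝓔_α` along `Γ`, is the right-hand side of
the Hamel equation. -/
theorem contraction_eq {n r dX : ℕ} {c : Fin n → Fin n → Fin n → ℝ}
    (hcanti : ∀ i j k, c i j k = -c j i k)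
    (κ : Fin dX → Fin dX → Fin n → ℝ) {ℰ : (Fin dX → ℝ) → Matrix (Fin n) (Fin n) ℝ}
    (hℰ : ∀ Γ, IsUnit (ℰ Γ).det) (Dξℓ : (Fin n → ℝ) → (Fin dX → ℝ) → Fin n → ℝ)
    (x : Fin dX → ℝ)
    (v : ℝ → Fin (n - r) → ℝ) (Γ : ℝ → Fin dX → ℝ) (t : ℝ) (α : Fin (n - r)) :
    (∑ l, ((∑ i, ∑ k, xiCurve n r dX ℰ v Γ t i * c i l k
              * Dξℓ (xiCurve n r dX ℰ v Γ t) (Γ t) k)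
            + (-∑ i, ∑ k, κ k i l * Γ t k * x i)) * ℰ (Γ t) l (dEmb n r α))
      + ∑ l, Dξℓ (xiCurve n r dX ℰ v Γ t) (Γ t) l
            * ∑ i, fderiv ℝ (fun Γ' => ℰ Γ' l (dEmb n r α)) (Γ t) (Pi.single i 1)
              * (-∑ j, ∑ k, κ k i j * xiCurve n r dX ℰ v Γ t j * Γ t k)
      = (-∑ β, ∑ i, calB n r dX c κ ℰ (Γ t) i α β * pCurve n r dX ℰ Dξℓ v Γ t i * v t β)
        + ∑ j, ∑ k, calK n dX κ ℰ (Γ t) (dEmb n r α) j k * x j * Γ t k := by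
  have hK : ∑ j, ∑ k, calK n dX κ ℰ (Γ t) (dEmb n r α) j k * x j * Γ t k
      = -∑ l, (∑ i, ∑ k, κ k i l * Γ t k * x i) * ℰ (Γ t) l (dEmb n r α) := by
    simp only [calK, Finset.sum_mul, neg_mul, Finset.sum_neg_distrib, neg_inj]
    rw [Finset.sum_comm (γ := Fin n)]
    refine Finset.sum_congr rfl fun j _ => ?_
    rw [Finset.sum_comm]
    exact Finset.sum_congr rfl fun l _ => Finset.sum_congr rfl fun k _ => by ring
  have hC : ∑ l, (∑ i, ∑ k, xiCurve n r dX ℰ v Γ t i * c i l k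
              * Dξℓ (xiCurve n r dX ℰ v Γ t) (Γ t) k) * ℰ (Γ t) l (dEmb n r α)
      = -∑ l, ∑ m, ∑ p, ℰ (Γ t) l (dEmb n r α) * xiCurve n r dX ℰ v Γ t m * c l m p
            * Dξℓ (xiCurve n r dX ℰ v Γ t) (Γ t) p := by
    simp only [Finset.sum_mul, ← Finset.sum_neg_distrib]
    refine Finset.sum_congr rfl fun l _ => Finset.sum_congr rfl fun m _ =>
      Finset.sum_congr rfl fun p _ => ?_
    rw [hcanti m l p]
    ring
  rw [sum_sum_calB_mul_pCurve c κ hℰ, hK]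
  simp only [add_mul, neg_mul, mul_neg, Finset.sum_add_distrib, Finset.sum_neg_distrib, hC]
  ring

theorem hasDerivAt_pCurve {n r dX : ℕ} {ℰ : (Fin dX → ℝ) → Matrix (Fin n) (Fin n) ℝ}
    (hℰ : ∀ i j, Differentiable ℝ fun Γ => ℰ Γ i j)
    {Dξℓ : (Fin n → ℝ) → (Fin dX → ℝ) → Fin n → ℝ}
    {v : ℝ → Fin (n - r) → ℝ} {Γ : ℝ → Fin dX → ℝ} {t : ℝ} {μ' : Fin n → ℝ} {Γ' : Fin dX → ℝ}
    (hμ : ∀ l, HasDerivAt (fun u => Dξℓ (xiCurve n r dX ℰ v Γ u) (Γ u) l) (μ' l) t)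
    (hΓ : ∀ i, HasDerivAt (fun u => Γ u i) (Γ' i) t) (q : Fin n) :
    HasDerivAt (fun u => pCurve n r dX ℰ Dξℓ v Γ u q)
      ((∑ l, μ' l * ℰ (Γ t) l q) + ∑ l, Dξℓ (xiCurve n r dX ℰ v Γ t) (Γ t) l
        * ∑ i, fderiv ℝ (fun Γ' => ℰ Γ' l q) (Γ t) (Pi.single i 1) * Γ' i) t := by
  rw [← Finset.sum_add_distrib]
  exact HasDerivAt.fun_sum fun l _ => (hμ l).mul (hasDerivAt_comp_sum (hℰ l q) hΓ)

/-- Nonholonomic Euler–Poincaré equations with advected parameters in `Γ`-dependent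
quasivelocities: the equations with Lagrange multipliers (i) are equivalent to the
multiplier-free equations (ii). -/
theorem stmt_15 (n r dX : ℕ) (hr : 1 ≤ r) (hrn : r < n)
    (c : Fin n → Fin n → Fin n → ℝ)
    (hcanti : ∀ i j k, c i j k = -c j i k)
    (κ : Fin dX → Fin dX → Fin n → ℝ)
    (ℓ : (Fin n → ℝ) → (Fin dX → ℝ) → ℝ)
    (Dξℓ : (Fin n → ℝ) → (Fin dX → ℝ) → Fin n → ℝ)
    (DΓℓ : (Fin n → ℝ) → (Fin dX → ℝ) → Fin dX → ℝ)
    (hDξℓ : ∀ ξ Γ j, HasDerivAt (fun u : ℝ => ℓ (ξ + u • (Pi.single j 1 : Fin n → ℝ)) Γ) (Dξℓ ξ Γ j) 0)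
    (hDΓℓ : ∀ ξ Γ i, HasDerivAt (fun u : ℝ => ℓ ξ (Γ + u • (Pi.single i 1 : Fin dX → ℝ))) (DΓℓ ξ Γ i) 0)
    (hcont : Continuous fun q : (Fin n → ℝ) × (Fin dX → ℝ) => (Dξℓ q.1 q.2, DΓℓ q.1 q.2))
    (ℰ : (Fin dX → ℝ) → Matrix (Fin n) (Fin n) ℝ)
    (hℰdiff : ∀ i j, Differentiable ℝ fun Γ => ℰ Γ i j)
    (hℰbasis : ∀ Γ, IsUnit (ℰ Γ).det)
    (ψ : (Fin dX → ℝ) → Fin r → Fin n → ℝ)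
    (hψind : ∀ Γ, LinearIndependent ℝ fun a => ψ Γ a)
    (hψann : ∀ Γ a α, ∑ i, ψ Γ a i * ℰ Γ i (dEmb n r α) = 0)
    (v : ℝ → Fin (n - r) → ℝ) (Γc : ℝ → Fin dX → ℝ)
    (hv : Differentiable ℝ v) (hΓc : Differentiable ℝ Γc)
    (hμ : Differentiable ℝ fun t => Dξℓ (xiCurve n r dX ℰ v Γc t) (Γc t)) :
    (∃ lam : ℝ → Fin r → ℝ, ∀ t : ℝ,
      (∀ j : Fin n,
        HasDerivAt (fun u => Dξℓ (xiCurve n r dX ℰ v Γc u) (Γc u) j)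
          ((∑ i, ∑ k, xiCurve n r dX ℰ v Γc t i * c i j k
              * Dξℓ (xiCurve n r dX ℰ v Γc t) (Γc t) k)
            + (-∑ i, ∑ k, κ k i j * Γc t k * DΓℓ (xiCurve n r dX ℰ v Γc t) (Γc t) i)
            + ∑ a, lam t a * ψ (Γc t) a j) t) ∧
      (∀ i : Fin dX,
        HasDerivAt (fun u => Γc u i)
          (-∑ j, ∑ k, κ k i j * xiCurve n r dX ℰ v Γc t j * Γc t k) t))
    ↔
    (∀ t : ℝ,
      (∀ α : Fin (n - r),
        HasDerivAt (fun u => pCurve n r dX ℰ Dξℓ v Γc u (dEmb n r α))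
          ((-∑ β, ∑ i, calB n r dX c κ ℰ (Γc t) i α β
              * pCurve n r dX ℰ Dξℓ v Γc t i * v t β)
            + ∑ j, ∑ k, calK n dX κ ℰ (Γc t) (dEmb n r α) j k
              * DΓℓ (xiCurve n r dX ℰ v Γc t) (Γc t) j * Γc t k) t) ∧
      (∀ i : Fin dX,
        HasDerivAt (fun u => Γc u i)
          (-∑ β, ∑ k, varkappa n r dX κ ℰ (Γc t) k i β * v t β * Γc t k) t)) := by
  simp only [sum_varkappa_mul_mul]
  constructor
  · rintro ⟨lam, h⟩ t
    obtain ⟨hμ', hΓ'⟩ := h t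
    refine ⟨fun α => ?_, hΓ'⟩
    convert hasDerivAt_pCurve hℰdiff hμ' hΓ' (dEmb n r α) using 1
    rw [← contraction_eq hcanti κ hℰbasis]
    congr 1
    have hlam : ∑ l, (∑ a, lam t a * ψ (Γc t) a l) * ℰ (Γc t) l (dEmb n r α) = 0 := by
      simp only [Finset.sum_mul]
      rw [Finset.sum_comm]
      simp only [mul_assoc, ← Finset.mul_sum, hψann, mul_zero, Finset.sum_const_zero]
    simp only [add_mul _ (∑ a, lam t a * ψ (Γc t) a _), Finset.sum_add_distrib, hlam, add_zero]
  · intro h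
    have hμ' : ∀ t l, HasDerivAt (fun u => Dξℓ (xiCurve n r dX ℰ v Γc u) (Γc u) l)
        (deriv (fun u => Dξℓ (xiCurve n r dX ℰ v Γc u) (Γc u)) t l) t := fun t =>
      hasDerivAt_pi.1 (hμ t).hasDerivAt
    have key : ∀ t, ∃ lam : Fin r → ℝ, ∀ l,
        deriv (fun u => Dξℓ (xiCurve n r dX ℰ v Γc u) (Γc u)) t l
          - ((∑ i, ∑ k, xiCurve n r dX ℰ v Γc t i * c i l k
              * Dξℓ (xiCurve n r dX ℰ v Γc t) (Γc t) k)
            + (-∑ i, ∑ k, κ k i l * Γc t k * DΓℓ (xiCurve n r dX ℰ v Γc t) (Γc t) i))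
          = ∑ a, lam a * ψ (Γc t) a l := by
      intro t
      refine exists_sum_smul_of_annihilates hrn.le (hℰbasis (Γc t)) (hψind _) (hψann _)
        (w := fun l => _) fun α => ?_
      have hp := (hasDerivAt_pCurve hℰdiff (hμ' t) (h t).2 (dEmb n r α)).unique ((h t).1 α)
      rw [← contraction_eq hcanti κ hℰbasis] at hp
      simp only [sub_mul _ _ (ℰ (Γc t) _ _), Finset.sum_sub_distrib]
      exact sub_eq_zero.2 (add_right_cancel hp)
    choose lam hlam using key
    refine ⟨lam, fun t => ⟨fun l => ?_, (h t).2⟩⟩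
    rw [← hlam t l, add_sub_cancel]
    exact hμ' t l

end
end
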